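/- arXiv:1002.3769 — 3 statements merged into one kernel-verified Lean document; each statement's English description precedes it below -/
import Mathlib

section
/- Let (P,r) be a poly-ribbon of scale s ≥ 1 using a tile system T in neighborhood N_vN. Then the constituent ribbons, translated by s times their grid positions and concatenated in the order given by P, form a T-ribbon: there exists a T-ribbon (Q, r'') whose path Q traverses consecutively, in the order i of dom(P), the translated paths sP(i) + P_i (where r(P(i)) = (P_i, r_i)), and such that r''(sP(i) + P_i(j)) = r_i(P_i(j)) for every i and every j ∈ dom(P_i). -/
namespace Paper

open scoped Classical

abbrev Pos : Type := ℤ × ℤ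

/-- The von Neumann neighborhood. -/
def Nvn : Set Pos := {(0, 1), (1, 0), (0, -1), (-1, 0)}

/-- A neighborhood: a finite symmetric set of positions not containing the origin. -/
def IsNeighborhood (N : Set Pos) : Prop :=
  N.Finite ∧ (0, 0) ∉ N ∧ ∀ w ∈ N, -w ∈ N

/-- A tile over glues `X` and neighborhood `N` : a function from `N` to `X`. -/
abbrev Tile (X : Type) (N : Set Pos) : Type := {w : Pos // w ∈ N} → X

/-- Scaling a position by an integer. -/
def sc (s : ℤ) (u : Pos) : Pos := (s * u.1, s * u.2)

/-- Domain of a partial map on the plane. -/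
def tdom {α : Type} (τ : Pos → Option α) : Set Pos := {p | τ p ≠ none}

/-- A (T,N)-tiling: a partial map to tiles of `T` such that all neighboring glues match. -/
def IsTiling {X : Type} {N : Set Pos} (T : Set (Tile X N))
    (τ : Pos → Option (Tile X N)) : Prop :=
  (∀ p t, τ p = some t → t ∈ T) ∧
  (∀ p t, τ p = some t → ∀ w t', τ (p + w) = some t' →
    ∀ (hw : w ∈ N) (hw' : -w ∈ N), t ⟨w, hw⟩ = t' ⟨-w, hw'⟩)

def IsFiniteTiling {X : Type} {N : Set Pos} (T : Set (Tile X N))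
    (τ : Pos → Option (Tile X N)) : Prop :=
  IsTiling T τ ∧ (tdom τ).Finite

/-- A partial map on the plane is total if it is defined everywhere. -/
def TotalDom {α : Type} (τ : Pos → Option α) : Prop := ∀ p, τ p ≠ none

/-- A poly-tiling of scale `s`: a partial map from grid positions to finite tilings,
satisfying (i) each component is a finite tiling, (ii) translated domains are disjoint,
(iii) neighboring (after translation) tiles of two components have matching glues. -/
def IsPolyTiling {X : Type} {N : Set Pos} (T : Set (Tile X N)) (s : ℤ)
    (σ : Pos → Option (Pos → Option (Tile X N))) : Prop :=
  (∀ u τu, σ u = some τu → IsFiniteTiling T τu) ∧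
  (∀ u v τu τv, u ≠ v → σ u = some τu → σ v = some τv →
    ∀ p, τu p ≠ none → ∀ q, τv q ≠ none → sc s u + p ≠ sc s v + q) ∧
  (∀ u u' τu τu', σ u = some τu → σ u' = some τu' →
    ∀ v t, τu v = some t → ∀ v' t', τu' v' = some t' →
    ∀ (hw : (sc s u' + v') - (sc s u + v) ∈ N)
      (hw' : -((sc s u' + v') - (sc s u + v)) ∈ N),
      t ⟨(sc s u' + v') - (sc s u + v), hw⟩ =
        t' ⟨-((sc s u' + v') - (sc s u + v)), hw'⟩)

/-- The tiling induced by a poly-tiling: position `s•u + v` carries the tile `σ u v`. -/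
noncomputable def induced {α : Type} (s : ℤ) (σ : Pos → Option (Pos → Option α)) :
    Pos → Option α := fun p =>
  if h : ∃ t, ∃ u τu v, σ u = some τu ∧ τu v = some t ∧ p = sc s u + v
    then some h.choose else none

/-- Periodicity of a (partial) tiling, with horizontal and vertical periods. -/
def PeriodicT {α : Type} (τ : Pos → Option α) : Prop :=
  ∃ ph pv : ℤ, 0 < ph ∧ 0 < pv ∧
    ∀ (p : Pos) (a b : ℤ), τ p ≠ none →
      τ (p.1 + a * ph, p.2 + b * pv) ≠ none →
      τ p = τ (p.1 + a * ph, p.2 + b * pv)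

def LineConvex {α : Type} (τ : Pos → Option α) : Prop :=
  ∀ x₁ x₂ x y : ℤ, τ (x₁, y) ≠ none → τ (x₂, y) ≠ none →
    x₁ < x → x < x₂ → τ (x, y) ≠ none

def ColumnConvex {α : Type} (τ : Pos → Option α) : Prop :=
  ∀ x y₁ y₂ y : ℤ, τ (x, y₁) ≠ none → τ (x, y₂) ≠ none →
    y₁ < y → y < y₂ → τ (x, y) ≠ none

/-- 4-connectedness of a set of positions. -/
def ConnectedDom (D : Set Pos) : Prop :=
  ∀ p ∈ D, ∀ q ∈ D, ∃ (n : ℕ) (c : ℕ → Pos), c 0 = p ∧ c n = q ∧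
    (∀ k ≤ n, c k ∈ D) ∧ ∀ k < n, c (k + 1) - c k ∈ Nvn

/-- The connected linear neighborhood `N_n`. -/
def Nlin (n : ℤ) : Set Pos := {w | w.2 = 0 ∧ 0 < |w.1| ∧ |w.1| ≤ n}

/-- The rectangular neighborhood `N_{m,n}`. -/
def Nrect (m n : ℤ) : Set Pos := {w | |w.1| ≤ m ∧ |w.2| ≤ n ∧ w ≠ (0, 0)}

/-- A set of consecutive integers. -/
def IsInterval (I : Set ℤ) : Prop :=
  ∀ a b c : ℤ, a ∈ I → c ∈ I → a ≤ b → b ≤ c → b ∈ I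

/-- A path: a map from a set of consecutive integers to the plane, consecutive
positions being (von Neumann) adjacent. -/
def IsPath (I : Set ℤ) (P : ℤ → Pos) : Prop :=
  IsInterval I ∧ ∀ i : ℤ, i ∈ I → i + 1 ∈ I → P (i + 1) - P i ∈ Nvn

/-- A T-tiled path: a path together with a map from its range to tiles of `T`. -/
def IsTiledPath {X : Type} {N : Set Pos} (T : Set (Tile X N)) (I : Set ℤ)
    (P : ℤ → Pos) (r : Pos → Option (Tile X N)) : Prop :=
  IsPath I P ∧ tdom r = P '' I ∧ ∀ p t, r p = some t → t ∈ T

/-- A T-ribbon: an injective tiled path in which consecutive tiles stick. -/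
def IsRibbon {X : Type} (T : Set (Tile X Nvn)) (I : Set ℤ) (P : ℤ → Pos)
    (r : Pos → Option (Tile X Nvn)) : Prop :=
  IsTiledPath T I P r ∧ (∀ i ∈ I, ∀ j ∈ I, P i = P j → i = j) ∧
  (∀ i : ℤ, i ∈ I → i + 1 ∈ I → ∀ t t', r (P i) = some t → r (P (i + 1)) = some t' →
    ∀ (hv : P (i + 1) - P i ∈ Nvn) (hv' : -(P (i + 1) - P i) ∈ Nvn),
      t ⟨P (i + 1) - P i, hv⟩ = t' ⟨-(P (i + 1) - P i), hv'⟩)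

/-- A (T,N)-zipper: an injective tiled path whose tile map is a (T,N)-tiling. -/
def IsZipper {X : Type} {N : Set Pos} (T : Set (Tile X N)) (I : Set ℤ)
    (P : ℤ → Pos) (r : Pos → Option (Tile X N)) : Prop :=
  IsTiledPath T I P r ∧ (∀ i ∈ I, ∀ j ∈ I, P i = P j → i = j) ∧ IsTiling T r

/-- Bundled T-ribbons (tile system in the von Neumann neighborhood). -/
structure Ribbon (X : Type) (T : Set (Tile X Nvn)) : Type where
  I : Set ℤ
  P : ℤ → Pos
  r : Pos → Option (Tile X Nvn)
  isRibbon : IsRibbon T I P r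

/-- A poly-ribbon of scale `s` with macro path `(J, Q)` and components `ρ`. -/
def IsPolyRibbon {X : Type} {T : Set (Tile X Nvn)} (s : ℤ) (J : Set ℤ)
    (Q : ℤ → Pos) (ρ : Pos → Option (Ribbon X T)) : Prop :=
  IsPath J Q ∧ (∀ i ∈ J, ∀ j ∈ J, Q i = Q j → i = j) ∧
  tdom ρ = Q '' J ∧
  (∀ u R, ρ u = some R → R.I.Finite ∧ R.I.Nonempty) ∧
  (∀ u v R S, u ≠ v → ρ u = some R → ρ v = some S →
    ∀ p, R.r p ≠ none → ∀ q, S.r q ≠ none → sc s u + p ≠ sc s v + q) ∧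
  (∀ j : ℤ, j ∈ J → j + 1 ∈ J → ∀ R₁ R₂, ρ (Q j) = some R₁ → ρ (Q (j + 1)) = some R₂ →
    ∀ m₁, IsGreatest R₁.I m₁ → ∀ m₂, IsLeast R₂.I m₂ →
      ((sc s (Q (j + 1)) + R₂.P m₂) - (sc s (Q j) + R₁.P m₁) ∈ Nvn ∧
      ∀ t₁ t₂, R₁.r (R₁.P m₁) = some t₁ → R₂.r (R₂.P m₂) = some t₂ →
        ∀ (hv : (sc s (Q (j + 1)) + R₂.P m₂) - (sc s (Q j) + R₁.P m₁) ∈ Nvn)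
          (hv' : -((sc s (Q (j + 1)) + R₂.P m₂) - (sc s (Q j) + R₁.P m₁)) ∈ Nvn),
          t₁ ⟨(sc s (Q (j + 1)) + R₂.P m₂) - (sc s (Q j) + R₁.P m₁), hv⟩ =
            t₂ ⟨-((sc s (Q (j + 1)) + R₂.P m₂) - (sc s (Q j) + R₁.P m₁)), hv'⟩))

/-- A zipper-simulation of `T` (in neighborhood `N`) by `Tμ` (in the von Neumann
neighborhood), of scale `s`, consisting of a polyomino assignment `phi`, the
trimming map `chi` and the simulation map `psi`. -/
structure ZipperSimulation (X Xμ : Type) (N : Set Pos) (T : Set (Tile X N))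
    (Tμ : Set (Tile Xμ Nvn)) (s : ℤ) : Type where
  hs : 1 ≤ s
  phi : Tile X N → Set (Ribbon Xμ Tμ)
  phi_fin : ∀ t, ∀ R ∈ phi t, R.I.Finite ∧ R.I.Nonempty
  phi_ref : ∀ t, ∀ R ∈ phi t, R.r (0, 0) ≠ none
  phi_spec : ∀ t t', t ≠ t' → ∀ R ∈ phi t, ∀ S ∈ phi t',
    ∀ p q a b, R.r p = some a → S.r q = some b → a ≠ b
  chi : Ribbon Xμ Tμ → Pos → Option (Ribbon Xμ Tμ)
  chi_poly : ∀ R : Ribbon Xμ Tμ, ∃ J Q, IsPolyRibbon s J Q (chi R)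
  chi_sub : ∀ R u S, chi R u = some S →
    (∃ t ∈ T, S ∈ phi t) ∧ ∀ p a, S.r p = some a → R.r (sc s u + p) = some a
  chi_max : ∀ (R : Ribbon Xμ Tμ) (t : Tile X N), t ∈ T → ∀ S ∈ phi t, ∀ u : Pos,
    (∀ p a, S.r p = some a → R.r (sc s u + p) = some a) → chi R u ≠ none
  psi : Set ℤ → (ℤ → Pos) → (Pos → Option (Tile X N)) → Set (Pos → Option (Ribbon Xμ Tμ))
  psi_nonempty : ∀ I P r, IsZipper T I P r → (psi I P r).Nonempty
  psi_poly : ∀ I P r, IsZipper T I P r → ∀ ρ ∈ psi I P r, IsPolyRibbon s I P ρ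
  psi_comp : ∀ I P r, IsZipper T I P r → ∀ ρ ∈ psi I P r,
    ∀ u t, r u = some t → ∀ S, ρ u = some S → S ∈ phi t
  psi_exists : ∀ R : Ribbon Xμ Tμ, ∃ I P r, IsZipper T I P r ∧ chi R ∈ psi I P r
  psi_unique : ∀ (R : Ribbon Xμ Tμ) I P r I' P' r',
    IsZipper T I P r → IsZipper T I' P' r' →
    chi R ∈ psi I P r → chi R ∈ psi I' P' r' →
    r = r' ∧ ∃ d : ℤ, (∀ i, i ∈ I ↔ i + d ∈ I') ∧ ∀ i ∈ I, P' (i + d) = P i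

/-- A tiling-simulation of `T` (in neighborhood `N`) by `Tμ` (in the von Neumann
neighborhood), of scale `s`, consisting of a polyomino assignment `phi`, the
trimming map `chi` and the simulation map `psi`. -/
structure TilingSimulation (X Xμ : Type) (N : Set Pos) (T : Set (Tile X N))
    (Tμ : Set (Tile Xμ Nvn)) (s : ℤ) : Type where
  hs : 1 ≤ s
  phi : Tile X N → Set (Pos → Option (Tile Xμ Nvn))
  phi_fin : ∀ t, ∀ τ' ∈ phi t, IsFiniteTiling Tμ τ'
  phi_ref : ∀ t, ∀ τ' ∈ phi t, τ' (0, 0) ≠ none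
  phi_spec : ∀ t t', t ≠ t' → ∀ τ₁ ∈ phi t, ∀ τ₂ ∈ phi t',
    ∀ p q a b, τ₁ p = some a → τ₂ q = some b → a ≠ b
  chi : (Pos → Option (Tile Xμ Nvn)) → Pos → Option (Pos → Option (Tile Xμ Nvn))
  chi_poly : ∀ τ', IsTiling Tμ τ' → IsPolyTiling Tμ s (chi τ')
  chi_sub : ∀ τ' u σu, chi τ' u = some σu →
    (∃ t ∈ T, σu ∈ phi t) ∧ ∀ p a, σu p = some a → τ' (sc s u + p) = some a
  chi_max : ∀ (τ' : Pos → Option (Tile Xμ Nvn)) (t : Tile X N), t ∈ T →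
    ∀ σu ∈ phi t, ∀ u : Pos,
    (∀ p a, σu p = some a → τ' (sc s u + p) = some a) → chi τ' u ≠ none
  psi : (Pos → Option (Tile X N)) → Set (Pos → Option (Pos → Option (Tile Xμ Nvn)))
  psi_nonempty : ∀ τ, IsTiling T τ → (psi τ).Nonempty
  psi_poly : ∀ τ, IsTiling T τ → ∀ σ ∈ psi τ, IsPolyTiling Tμ s σ
  psi_dom : ∀ τ, IsTiling T τ → ∀ σ ∈ psi τ, ∀ u, σ u ≠ none ↔ τ u ≠ none
  psi_comp : ∀ τ, IsTiling T τ → ∀ σ ∈ psi τ,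
    ∀ u t, τ u = some t → ∀ σu, σ u = some σu → σu ∈ phi t
  psi_recover : ∀ τ', IsTiling Tμ τ' → ∃! τ, IsTiling T τ ∧ chi τ' ∈ psi τ

/-- The glues of two tiles agree across the edge in direction `v`. -/
def Sticks {X : Type} {N : Set Pos} (t t' : Tile X N) (v : Pos) : Prop :=
  ∀ (hv : v ∈ N) (hv' : -v ∈ N), t ⟨v, hv⟩ = t' ⟨-v, hv'⟩

/-- Blocks of positive integer lengths `L j` tile `ℤ`: block `j` starts at `o j`, and the
integer `i` lies in the block number `idx i`. -/
lemma exists_block_index (L : ℤ → ℤ) (hL : ∀ j, 1 ≤ L j) :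
    ∃ o idx : ℤ → ℤ, StrictMono o ∧ (∀ j, o (j + 1) = o j + L j) ∧
      ∀ i j, idx i = j ↔ o j ≤ i ∧ i < o (j + 1) := by
  obtain ⟨o, ho⟩ : ∃ o : ℤ → ℤ, ∀ j, o (j + 1) = o j + L j := by
    refine ⟨fun j => ∑ m ∈ Finset.Ico 0 j, L m - ∑ m ∈ Finset.Ico j 0, L m, fun j => ?_⟩
    rcases lt_or_ge j 0 with hj | hj
    · have h : Finset.Ico j 0 = insert j (Finset.Ico (j + 1) 0) := by
        ext m; simp only [Finset.mem_Ico, Finset.mem_insert]; omega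
      simp [h, Finset.Ico_eq_empty_of_le (show j + 1 ≤ 0 by omega),
        Finset.Ico_eq_empty_of_le hj.le]
    · have h : Finset.Ico 0 (j + 1) = insert j (Finset.Ico 0 j) := by
        ext m; simp only [Finset.mem_Ico, Finset.mem_insert]; omega
      simp [h, Finset.Ico_eq_empty_of_le (show 0 ≤ j + 1 by omega),
        Finset.Ico_eq_empty_of_le hj, add_comm]
  have hmono : StrictMono o := strictMono_int_of_lt_succ fun j => by
    have := hL j; have := ho j; omega
  have hgrow (d : ℕ) : ∀ j, o j + d ≤ o (j + d) := by
    induction d with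
    | zero => simp
    | succ d ih =>
      intro j
      have h₁ := ih j
      have h₂ := hL (j + d)
      have h₃ := ho (j + d)
      push_cast
      rw [← add_assoc j]
      omega
  have hex (i : ℤ) : ∃ j, o j ≤ i ∧ i < o (j + 1) := by
    obtain ⟨j, hj, hmax⟩ := Int.exists_greatest_of_bdd (P := fun j => o j ≤ i)
      ⟨(i - o 0).toNat, fun z hz => by
        by_contra! h
        have h₁ := hmono h
        have h₂ := hgrow (i - o 0).toNat 0
        rw [zero_add] at h₂
        omega⟩
      ⟨-(o 0 - i).toNat, by
        have h := hgrow (o 0 - i).toNat (-(o 0 - i).toNat)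
        rw [neg_add_cancel] at h
        omega⟩
    refine ⟨j, hj, ?_⟩
    by_contra! h
    have := hmax _ h
    omega
  choose idx hidx using hex
  refine ⟨o, idx, hmono, ho, fun i j => ⟨fun h => h ▸ hidx i, fun h => ?_⟩⟩
  have h₁ := hmono.lt_iff_lt.1 ((hidx i).1.trans_lt h.2)
  have h₂ := hmono.lt_iff_lt.1 (h.1.trans_lt (hidx i).2)
  omega

/-- An injective path whose indices are labelled by tiles sticking consecutively is a ribbon. -/
lemma exists_isRibbon_of_labelled_path {X : Type} {T : Set (Tile X Nvn)} {I : Set ℤ}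
    {P : ℤ → Pos} (t : ℤ → Option (Tile X Nvn)) (hI : IsPath I P)
    (hinj : ∀ i ∈ I, ∀ j ∈ I, P i = P j → i = j)
    (ht : ∀ i ∈ I, ∃ x ∈ T, t i = some x)
    (hstick : ∀ i, i ∈ I → i + 1 ∈ I → ∀ x x', t i = some x → t (i + 1) = some x' →
      Sticks x x' (P (i + 1) - P i)) :
    ∃ r, IsRibbon T I P r ∧ ∀ i ∈ I, r (P i) = t i := by
  have hinj' : Function.Injective (fun i : I => P i) := fun i j h =>
    Subtype.ext (hinj _ i.2 _ j.2 h)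
  let r : Pos → Option (Tile X Nvn) :=
    Function.extend (fun i : I => P i) (fun i => t i) (fun _ => none)
  have hr : ∀ i ∈ I, r (P i) = t i := fun i hi => hinj'.extend_apply _ _ (⟨i, hi⟩ : I)
  have hdom : ∀ p, r p ≠ none → ∃ i ∈ I, P i = p := by
    intro p hp
    by_contra! h
    exact hp (Function.extend_apply' _ _ _ fun ⟨i, hi⟩ => h i i.2 hi)
  refine ⟨r, ⟨⟨hI, ?_, ?_⟩, hinj, ?_⟩, hr⟩
  · ext p
    refine ⟨hdom p, ?_⟩
    rintro ⟨i, hi, rfl⟩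
    obtain ⟨x, -, hx⟩ := ht i hi
    simp [tdom, hr i hi, hx]
  · intro p x hx
    obtain ⟨i, hi, rfl⟩ := hdom p (by simp [hx])
    obtain ⟨y, hy, hiy⟩ := ht i hi
    rw [hr i hi, hiy] at hx
    exact Option.some.inj hx ▸ hy
  · intro i hi hi' x x' hx hx'
    rw [hr _ hi] at hx
    rw [hr _ hi'] at hx'
    exact hstick i hi hi' x x' hx hx'

/-- A nonempty finite set of consecutive integers is a closed interval. -/
lemma IsInterval.exists_eq_Icc {I : Set ℤ} (hI : IsInterval I) (hfin : I.Finite)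
    (hne : I.Nonempty) : ∃ a b, a ≤ b ∧ I = Set.Icc a b := by
  obtain ⟨a, ha⟩ := hfin.exists_minimal hne
  obtain ⟨b, hb⟩ := hfin.exists_maximal hne
  have hab : ∀ k ∈ I, a ≤ k ∧ k ≤ b := fun k hk =>
    ⟨(le_total a k).elim id (ha.2 hk), (le_total k b).elim id (hb.2 hk)⟩
  exact ⟨a, b, (hab b hb.1).1, Set.ext fun k =>
    ⟨hab k, fun hk => hI a k b ha.1 hb.1 hk.1 hk.2⟩⟩

namespace Ribbon

variable {X : Type} {T : Set (Tile X Nvn)}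

instance : Nonempty (Ribbon X T) :=
  ⟨⟨∅, fun _ => 0, fun _ => none, by
    simp [IsRibbon, IsTiledPath, IsPath, IsInterval, tdom]⟩⟩

lemma exists_tile (R : Ribbon X T) {k : ℤ} (hk : k ∈ R.I) :
    ∃ x ∈ T, R.r (R.P k) = some x := by
  have h : R.P k ∈ tdom R.r := R.isRibbon.1.2.1 ▸ Set.mem_image_of_mem _ hk
  obtain ⟨x, hx⟩ := Option.ne_none_iff_exists'.1 h
  exact ⟨x, R.isRibbon.1.2.2 _ _ hx, hx⟩

end Ribbon

/-- The components of a poly-ribbon, indexed by integers; only indices in `J` matter. -/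
lemma IsPolyRibbon.exists_components {X : Type} {T : Set (Tile X Nvn)} {s : ℤ} {J : Set ℤ}
    {Q : ℤ → Pos} {ρ : Pos → Option (Ribbon X T)} (h : IsPolyRibbon s J Q ρ) :
    ∃ (R : ℤ → Ribbon X T) (a b : ℤ → ℤ), (∀ j, a j ≤ b j) ∧
      ∀ j ∈ J, ρ (Q j) = some (R j) ∧ (R j).I = Set.Icc (a j) (b j) := by
  obtain ⟨-, -, hdom, hfin, -⟩ := h
  have key (j : ℤ) : ∃ (R : Ribbon X T) (a b : ℤ), a ≤ b ∧
      (j ∈ J → ρ (Q j) = some R ∧ R.I = Set.Icc a b) := by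
    by_cases hj : j ∈ J
    · have hne : Q j ∈ tdom ρ := hdom ▸ Set.mem_image_of_mem _ hj
      obtain ⟨R, hR⟩ := Option.ne_none_iff_exists'.1 hne
      obtain ⟨a, b, hab, hI⟩ := R.isRibbon.1.1.1.exists_eq_Icc (hfin _ _ hR).1 (hfin _ _ hR).2
      exact ⟨R, a, b, hab, fun _ => ⟨hR, hI⟩⟩
    · exact ⟨Classical.arbitrary _, 0, 0, le_rfl, fun h => absurd h hj⟩
  choose R a b hab hR using key
  exact ⟨R, a, b, hab, hR⟩

/-- the constituent ribbons of a poly-ribbon of scale `s ≥ 1`,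
translated by `s` times their grid positions and concatenated in the order of the
macro path, form a T-ribbon.  The function `e` gives, for macro index `j` and a
position `k` in the `j`-th constituent ribbon, the corresponding index of the big
ribbon. -/
theorem stmt2 (X : Type) [Fintype X] (T : Set (Tile X Nvn)) (hT : T.Finite)
    (s : ℤ) (hs : 1 ≤ s) (J : Set ℤ) (Q : ℤ → Pos) (ρ : Pos → Option (Ribbon X T))
    (hpoly : IsPolyRibbon s J Q ρ) :
    ∃ (I : Set ℤ) (P : ℤ → Pos) (r : Pos → Option (Tile X Nvn)) (e : ℤ → ℤ → ℤ),
      IsRibbon T I P r ∧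
      -- each translated constituent position appears on the big ribbon, carrying
      -- the same tile
      (∀ j ∈ J, ∀ R, ρ (Q j) = some R → ∀ k ∈ R.I,
        e j k ∈ I ∧ P (e j k) = sc s (Q j) + R.P k ∧
        r (sc s (Q j) + R.P k) = R.r (R.P k)) ∧
      -- the traversal respects the order inside each constituent ribbon
      (∀ j ∈ J, ∀ R, ρ (Q j) = some R → ∀ k : ℤ, k ∈ R.I → k + 1 ∈ R.I →
        e j (k + 1) = e j k + 1) ∧
      -- consecutive constituent ribbons are traversed consecutively
      (∀ j : ℤ, j ∈ J → j + 1 ∈ J → ∀ R₁ R₂, ρ (Q j) = some R₁ →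
        ρ (Q (j + 1)) = some R₂ →
        ∀ m₁, IsGreatest R₁.I m₁ → ∀ m₂, IsLeast R₂.I m₂ →
          e (j + 1) m₂ = e j m₁ + 1) ∧
      -- the big ribbon consists exactly of the translated constituent ribbons
      (∀ i ∈ I, ∃ j ∈ J, ∃ R, ρ (Q j) = some R ∧ ∃ k ∈ R.I, e j k = i) := by
  obtain ⟨R, a, b, hab, hR⟩ := hpoly.exists_components
  obtain ⟨⟨hJ, -⟩, hQinj, -, -, hdisj, hjoin⟩ := hpoly
  obtain ⟨o, idx, hmono, ho, hidx⟩ :=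
    exists_block_index (fun j => b j - a j + 1) fun j => by have := hab j; omega
  have hspec (i : ℤ) : o (idx i) ≤ i ∧ i < o (idx i + 1) := (hidx i _).1 rfl
  let loc : ℤ → ℤ := fun i => i - o (idx i) + a (idx i)
  let P : ℤ → Pos := fun i => sc s (Q (idx i)) + (R (idx i)).P (loc i)
  have hloc (i : ℤ) (hi : idx i ∈ J) : loc i ∈ (R (idx i)).I := by
    rw [(hR _ hi).2]
    have h₁ := hspec i
    have h₂ := ho (idx i)
    simp only [loc, Set.mem_Icc]
    omega
  have hidx_e (j : ℤ) (hj : j ∈ J) (k : ℤ) (hk : k ∈ (R j).I) : idx (o j + (k - a j)) = j := by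
    rw [(hR j hj).2, Set.mem_Icc] at hk
    rw [hidx, ho]
    omega
  have hstep (i : ℤ) : (idx (i + 1) = idx i ∧ loc (i + 1) = loc i + 1) ∨
      (idx (i + 1) = idx i + 1 ∧ loc i = b (idx i) ∧ loc (i + 1) = a (idx i + 1)) := by
    have h₁ := hspec i
    have h₂ := ho (idx i)
    by_cases h : i + 1 < o (idx i + 1)
    · have h₃ : idx (i + 1) = idx i := (hidx _ _).2 ⟨by omega, h⟩
      refine Or.inl ⟨h₃, ?_⟩
      simp only [loc, h₃]
      omega
    · have h₃ : idx (i + 1) = idx i + 1 :=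
        (hidx _ _).2 ⟨by omega, by have := hmono (lt_add_one (idx i + 1)); omega⟩
      refine Or.inr ⟨h₃, ?_, ?_⟩
      · simp only [loc]
        omega
      · simp only [loc, h₃]
        omega
  have hleast (j : ℤ) (hj : j ∈ J) : IsLeast (R j).I (a j) :=
    (hR j hj).2 ▸ isLeast_Icc (hab j)
  have hgreatest (j : ℤ) (hj : j ∈ J) : IsGreatest (R j).I (b j) :=
    (hR j hj).2 ▸ isGreatest_Icc (hab j)
  have hpath : IsPath (idx ⁻¹' J) P := by
    refine ⟨fun i₁ i i₂ h₁ h₂ hi₁ hi₂ => ?_, fun i hi hi' => ?_⟩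
    · have hidx_mono {m n : ℤ} (h : m ≤ n) : idx m ≤ idx n := by
        have := hmono.lt_iff_lt.1 ((hspec m).1.trans_lt (h.trans_lt (hspec n).2))
        omega
      exact hJ _ _ _ h₁ h₂ (hidx_mono hi₁) (hidx_mono hi₂)
    · rw [Set.mem_preimage] at hi hi'
      rcases hstep i with ⟨h₁, h₂⟩ | ⟨h₁, h₂, h₃⟩
      · have hk' := hloc _ hi'
        rw [h₁, h₂] at hk'
        simpa only [P, h₁, h₂, add_sub_add_left_eq_sub] using
          (R (idx i)).isRibbon.1.1.2 _ (hloc i hi) hk'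
      · rw [h₁] at hi'
        simpa only [P, h₁, h₂, h₃] using (hjoin _ hi hi' _ _ (hR _ hi).1 (hR _ hi').1
          _ (hgreatest _ hi) _ (hleast _ hi')).1
  have hPinj : ∀ i ∈ idx ⁻¹' J, ∀ i' ∈ idx ⁻¹' J, P i = P i' → i = i' := by
    intro i hi i' hi' h
    have hii' : idx i = idx i' := by
      by_contra hne
      obtain ⟨x, -, hx⟩ := (R _).exists_tile (hloc i hi)
      obtain ⟨x', -, hx'⟩ := (R _).exists_tile (hloc i' hi')
      exact hdisj _ _ _ _ (fun hQ => hne (hQinj _ hi _ hi' hQ)) (hR _ hi).1 (hR _ hi').1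
        _ (by simp [hx]) _ (by simp [hx']) h
    have hk' := hloc i' hi'
    simp only [P, ← hii', add_right_inj] at h hk'
    have := (R (idx i)).isRibbon.2.1 _ (hloc i hi) _ hk' h
    simp only [loc, hii'] at this
    omega
  obtain ⟨r, hr, hrP⟩ := exists_isRibbon_of_labelled_path (T := T)
    (fun i => (R (idx i)).r ((R (idx i)).P (loc i))) hpath hPinj
    (fun i hi => (R _).exists_tile (hloc i hi)) <| by
      intro i hi hi' x x' hx hx'
      rw [Set.mem_preimage] at hi hi'
      rcases hstep i with ⟨h₁, h₂⟩ | ⟨h₁, h₂, h₃⟩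
      · have hk' := hloc _ hi'
        rw [h₁, h₂] at hk'
        simp only [h₁, h₂] at hx'
        simp only [P, h₁, h₂, add_sub_add_left_eq_sub]
        exact (R (idx i)).isRibbon.2.2 _ (hloc i hi) hk' x x' hx hx'
      · rw [h₁] at hi'
        simp only [h₁, h₂, h₃] at hx hx'
        simp only [P, h₁, h₂, h₃]
        exact (hjoin _ hi hi' _ _ (hR _ hi).1 (hR _ hi').1
          _ (hgreatest _ hi) _ (hleast _ hi')).2 x x' hx hx'
  refine ⟨idx ⁻¹' J, P, r, fun j k => o j + (k - a j), hr, ?_, ?_, ?_, ?_⟩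
  · intro j hj R' hR' k hk
    obtain rfl : R j = R' := Option.some.inj ((hR j hj).1.symm.trans hR')
    have hj' := hidx_e j hj k hk
    have hmem : o j + (k - a j) ∈ idx ⁻¹' J := by rwa [Set.mem_preimage, hj']
    have hk' : loc (o j + (k - a j)) = k := by
      simp only [loc, hj']
      omega
    have hP : P (o j + (k - a j)) = sc s (Q j) + (R j).P k := by simp only [P, hj', hk']
    refine ⟨hmem, hP, ?_⟩
    rw [← hP, hrP _ hmem, hj', hk']
  · intro j _ _ _ k _ _
    dsimp only
    omega
  · intro j hj hj' R₁ R₂ h₁ h₂ m₁ hm₁ m₂ hm₂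
    obtain rfl : R j = R₁ := Option.some.inj ((hR j hj).1.symm.trans h₁)
    obtain rfl : R (j + 1) = R₂ := Option.some.inj ((hR _ hj').1.symm.trans h₂)
    have h₃ := hm₁.unique (hgreatest j hj)
    have h₄ := hm₂.unique (hleast _ hj')
    have h₅ := ho j
    dsimp only
    omega
  · intro i hi
    refine ⟨idx i, hi, R (idx i), (hR _ hi).1, loc i, hloc i hi, ?_⟩
    simp only [loc]
    omega

end Paper
end

section
/- Let T be a tile system in an arbitrary neighborhood N, with finite set of glues X. There exist a finite glue set X', a tile system T' in neighborhood N_vN over X', and a map π : T' → T such that: (a) for every total (T,N)-tiling τ there exists a total (T',N_vN)-tiling τ' with π(τ'(x,y)) = τ(x,y) for all (x,y) ∈ ℤ²; and (b) for every total (T',N_vN)-tiling τ', the map (x,y) ↦ π(τ'(x,y)) is a total (T,N)-tiling. -/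
namespace Paper

open scoped Classical

/-- Patterns of elements of `α` on the square `[-m, m]²`. -/
abbrev Pattern (α : Type) (m : ℕ) : Type :=
  Set.Icc (-(m : ℤ)) m × Set.Icc (-(m : ℤ)) m → α

namespace Pattern

variable {α : Type} {m : ℕ}

/-- The value of a pattern at a position, which is first clamped to the square. -/
def eval (f : Pattern α m) (u : Pos) : α :=
  f (Set.projIcc (-(m : ℤ)) m (by lia) u.1, Set.projIcc (-(m : ℤ)) m (by lia) u.2)

/-- The pattern seen through the square centred at `p`. -/
def window (m : ℕ) (g : Pos → α) (p : Pos) : Pattern α m :=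
  fun u => g (p.1 + u.1, p.2 + u.2)

lemma eval_window (g : Pos → α) (p u : Pos)
    (h₁ : u.1 ∈ Set.Icc (-(m : ℤ)) m) (h₂ : u.2 ∈ Set.Icc (-(m : ℤ)) m) :
    (window m g p).eval u = g (p + u) := by
  simp only [eval, window, Set.projIcc_of_mem _ h₁, Set.projIcc_of_mem _ h₂]
  rfl

/-- `f'` can be the pattern one step to the right of `f`. -/
def HorizCompat (f f' : Pattern α m) : Prop :=
  ∀ i j : ℤ, -(m : ℤ) ≤ i → i < m → j ∈ Set.Icc (-(m : ℤ)) m →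
    f.eval (i + 1, j) = f'.eval (i, j)

/-- `f'` can be the pattern one step above `f`. -/
def VertCompat (f f' : Pattern α m) : Prop :=
  ∀ i j : ℤ, i ∈ Set.Icc (-(m : ℤ)) m → -(m : ℤ) ≤ j → j < m →
    f.eval (i, j + 1) = f'.eval (i, j)

lemma horizCompat_window (g : Pos → α) (p : Pos) :
    HorizCompat (window m g p) (window m g (p + (1, 0))) := by
  intro i j hi hi' hj
  rw [eval_window _ _ _ (by simp only [Set.mem_Icc]; lia) hj,
    eval_window _ _ _ (by simp only [Set.mem_Icc]; lia) hj]
  congr 1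
  ext <;> simp; ring

lemma vertCompat_window (g : Pos → α) (p : Pos) :
    VertCompat (window m g p) (window m g (p + (0, 1))) := by
  intro i j hi hj hj'
  rw [eval_window _ _ _ hi (by simp only [Set.mem_Icc]; lia),
    eval_window _ _ _ hi (by simp only [Set.mem_Icc]; lia)]
  congr 1
  ext <;> simp; ring

end Pattern

/-- If moving by one step shifts a row of windows, the value at offset `i` is the central value
of the window `i` steps away. -/
lemma eq_central_of_shift {α : Type} {m : ℕ} (F : ℤ → ℤ → α)
    (h : ∀ p i, -(m : ℤ) ≤ i → i < m → F p (i + 1) = F (p + 1) i) (p i : ℤ)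
    (hi : i ∈ Set.Icc (-(m : ℤ)) m) : F p i = F (p + i) 0 := by
  obtain ⟨hi₁, hi₂⟩ := hi
  induction i using Int.induction_on generalizing p with
  | zero => simp
  | succ i ih =>
    rw [h p i (by lia) (by lia), ih (p + 1) (by lia) (by lia)]
    congr 1; ring
  | pred i ih =>
    have hstep := h (p - 1) (-(i : ℤ) - 1) (by lia) (by lia)
    rw [sub_add_cancel, sub_add_cancel] at hstep
    rw [← hstep, ih (p - 1) (by lia) (by lia)]
    congr 1; ring

lemma Pattern.eval_eq_eval_zero {α : Type} {m : ℕ} (f : Pos → Pattern α m)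
    (hh : ∀ p, HorizCompat (f p) (f (p + (1, 0))))
    (hv : ∀ p, VertCompat (f p) (f (p + (0, 1)))) (p u : Pos)
    (h₁ : u.1 ∈ Set.Icc (-(m : ℤ)) m) (h₂ : u.2 ∈ Set.Icc (-(m : ℤ)) m) :
    (f p).eval u = (f (p + u)).eval 0 := by
  obtain ⟨x, y⟩ := p
  obtain ⟨i, j⟩ := u
  have hx := eq_central_of_shift (m := m) (fun x i => (f (x, y)).eval (i, j))
    (fun x i hi hi' => by simpa using hh (x, y) i j hi hi' h₂) x i h₁
  have hy := eq_central_of_shift (m := m) (fun y j => (f (x + i, y)).eval (0, j))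
    (fun y j hj hj' => by simpa using hv (x + i, y) 0 j (by simp) hj hj') y j h₂
  exact hx.trans hy

lemma IsNeighborhood.exists_subset_square {N : Set Pos} (hN : IsNeighborhood N) :
    ∃ m : ℕ, ∀ w ∈ N, w.1 ∈ Set.Icc (-(m : ℤ)) m ∧ w.2 ∈ Set.Icc (-(m : ℤ)) m := by
  obtain ⟨m, hm⟩ := (hN.1.image fun w => w.1.natAbs + w.2.natAbs).bddAbove
  refine ⟨m, fun w hw => ?_⟩
  have := hm ⟨w, hw, rfl⟩
  simp only [Set.mem_Icc] at *
  lia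

def east : {w : Pos // w ∈ Nvn} := ⟨(1, 0), by simp [Nvn]⟩
def west : {w : Pos // w ∈ Nvn} := ⟨(-1, 0), by simp [Nvn]⟩
def north : {w : Pos // w ∈ Nvn} := ⟨(0, 1), by simp [Nvn]⟩
def south : {w : Pos // w ∈ Nvn} := ⟨(0, -1), by simp [Nvn]⟩

section WindowTiles

variable {X : Type} {N : Set Pos} {m : ℕ}

/-- The pattern at the centre of a tile whose glues are pairs of patterns: those of the two
endpoints of the edge, the left or lower one first. -/
def centralPattern (t : Tile (Pattern (Tile X N) m × Pattern (Tile X N) m) Nvn) :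
    Pattern (Tile X N) m :=
  (t east).1

/-- The central tile of a pattern is in `T` and matches the other tiles of the pattern. -/
def CentrallyValid (T : Set (Tile X N)) (f : Pattern (Tile X N) m) : Prop :=
  f.eval 0 ∈ T ∧ ∀ w (hw : w ∈ N) (hw' : -w ∈ N), f.eval 0 ⟨w, hw⟩ = f.eval w ⟨-w, hw'⟩

/-- The von Neumann tile system simulating `T` by overlapping windows. -/
def windowSystem (T : Set (Tile X N)) (m : ℕ) :
    Set (Tile (Pattern (Tile X N) m × Pattern (Tile X N) m) Nvn) :=
  {t | (t west).2 = centralPattern t ∧ (t north).1 = centralPattern t ∧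
    (t south).2 = centralPattern t ∧
    (centralPattern t).HorizCompat (t east).2 ∧ (centralPattern t).VertCompat (t north).2 ∧
    CentrallyValid T (centralPattern t)}

/-- The tile at `p` recording the windows of `g` around `p` and its four neighbors. -/
noncomputable def windowTile (m : ℕ) (g : Pos → Tile X N) (p : Pos) :
    Tile (Pattern (Tile X N) m × Pattern (Tile X N) m) Nvn :=
  fun d => if d.1 = (1, 0) ∨ d.1 = (0, 1)
    then (Pattern.window m g p, Pattern.window m g (p + d))
    else (Pattern.window m g (p + d), Pattern.window m g p)

lemma centralPattern_windowTile (g : Pos → Tile X N) (p : Pos) :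
    centralPattern (windowTile m g p) = Pattern.window m g p := by
  simp [centralPattern, windowTile, east]

lemma eval_zero_window (g : Pos → Tile X N) (p : Pos) :
    (Pattern.window m g p).eval 0 = g p := by
  rw [Pattern.eval_window _ _ _ (by simp) (by simp), add_zero]

lemma windowTile_mem {T : Set (Tile X N)}
    (hm : ∀ w ∈ N, w.1 ∈ Set.Icc (-(m : ℤ)) m ∧ w.2 ∈ Set.Icc (-(m : ℤ)) m)
    {g : Pos → Tile X N} (hg : IsTiling T fun p => some (g p)) (p : Pos) :
    windowTile m g p ∈ windowSystem T m := by
  simp only [windowSystem, Set.mem_ofPred_eq, centralPattern_windowTile]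
  refine ⟨?_, ?_, ?_, ?_, ?_, ?_, ?_⟩
  · simp [windowTile, west]
  · simp [windowTile, north]
  · simp [windowTile, south]
  · simpa [windowTile, east] using Pattern.horizCompat_window g p
  · simpa [windowTile, north] using Pattern.vertCompat_window g p
  · rw [eval_zero_window]
    exact hg.1 p _ rfl
  · intro w hw hw'
    rw [eval_zero_window, Pattern.eval_window _ _ _ (hm w hw).1 (hm w hw).2]
    exact hg.2 p _ rfl w _ rfl hw hw'

lemma isTiling_windowTile {T : Set (Tile X N)}
    (hm : ∀ w ∈ N, w.1 ∈ Set.Icc (-(m : ℤ)) m ∧ w.2 ∈ Set.Icc (-(m : ℤ)) m)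
    {g : Pos → Tile X N} (hg : IsTiling T fun p => some (g p)) :
    IsTiling (windowSystem T m) fun p => some (windowTile m g p) := by
  refine ⟨?_, ?_⟩
  · rintro p _ ⟨⟩
    exact windowTile_mem hm hg p
  · rintro p _ ⟨⟩ w _ ⟨⟩ hw hw'
    rcases hw with rfl | rfl | rfl | rfl <;>
      simp [windowTile, add_assoc] <;>
      exact congrArg _ (add_zero p).symm

lemma isTiling_central_of_isTiling_windowSystem {T : Set (Tile X N)}
    (hm : ∀ w ∈ N, w.1 ∈ Set.Icc (-(m : ℤ)) m ∧ w.2 ∈ Set.Icc (-(m : ℤ)) m)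
    {t : Pos → Tile (Pattern (Tile X N) m × Pattern (Tile X N) m) Nvn}
    (ht : IsTiling (windowSystem T m) fun p => some (t p)) :
    IsTiling T fun p => some ((centralPattern (t p)).eval 0) := by
  have hmem : ∀ p, t p ∈ windowSystem T m := fun p => ht.1 p _ rfl
  have hh (p : Pos) : (centralPattern (t p)).HorizCompat (centralPattern (t (p + (1, 0)))) := by
    have hglue : t p east = t (p + (1, 0)) west :=
      ht.2 p _ rfl (1, 0) _ rfl east.2 west.2
    rw [← (hmem (p + (1, 0))).1, ← hglue]
    exact (hmem p).2.2.2.1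
  have hv (p : Pos) : (centralPattern (t p)).VertCompat (centralPattern (t (p + (0, 1)))) := by
    have hglue : t p north = t (p + (0, 1)) south :=
      ht.2 p _ rfl (0, 1) _ rfl north.2 south.2
    rw [← (hmem (p + (0, 1))).2.2.1, ← hglue]
    exact (hmem p).2.2.2.2.1
  refine ⟨?_, ?_⟩
  · rintro p _ ⟨⟩
    exact (hmem p).2.2.2.2.2.1
  · rintro p _ ⟨⟩ w _ ⟨⟩ hw hw'
    rw [(hmem p).2.2.2.2.2.2 w hw hw',
      Pattern.eval_eq_eval_zero (fun p => centralPattern (t p)) hh hv p w (hm w hw).1 (hm w hw).2]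

end WindowTiles

lemma TotalDom.exists_eq_some {α : Type} {τ : Pos → Option α} (h : TotalDom τ) :
    ∃ g : Pos → α, τ = fun p => some (g p) := by
  choose g hg using fun p => Option.ne_none_iff_exists'.1 (h p)
  exact ⟨g, funext hg⟩

/-- simulation of total arbitrary-neighborhood tilings by total
von Neumann-neighborhood tilings, via a projection `π : T' → T`. -/
theorem stmt3 (X : Type) [Fintype X] (N : Set Pos) (hN : IsNeighborhood N)
    (T : Set (Tile X N)) (hT : T.Finite) :
    ∃ (X' : Type) (_ : Fintype X') (T' : Set (Tile X' Nvn)) (_ : T'.Finite)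
      (π : Tile X' Nvn → Tile X N),
      (∀ t' ∈ T', π t' ∈ T) ∧
      (∀ τ : Pos → Option (Tile X N), IsTiling T τ → TotalDom τ →
        ∃ τ' : Pos → Option (Tile X' Nvn), IsTiling T' τ' ∧ TotalDom τ' ∧
          ∀ p t', τ' p = some t' → τ p = some (π t')) ∧
      (∀ τ' : Pos → Option (Tile X' Nvn), IsTiling T' τ' → TotalDom τ' →
        IsTiling T (fun p => (τ' p).map π)) := by
  have : Finite {w : Pos // w ∈ N} := hN.1
  have : Finite {w : Pos // w ∈ Nvn} := Set.Finite.to_subtype (by simp [Nvn])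
  obtain ⟨m, hm⟩ := hN.exists_subset_square
  refine ⟨Pattern (Tile X N) m × Pattern (Tile X N) m, Fintype.ofFinite _,
    windowSystem T m, Set.toFinite _, fun t => (centralPattern t).eval 0, ?_, ?_, ?_⟩
  · exact fun t ht => ht.2.2.2.2.2.1
  · intro τ hτ hdom
    obtain ⟨g, rfl⟩ := hdom.exists_eq_some
    refine ⟨fun p => some (windowTile m g p), isTiling_windowTile hm hτ, by simp [TotalDom], ?_⟩
    rintro p _ ⟨⟩
    simp only [centralPattern_windowTile, eval_zero_window]
  · intro τ' hτ' hdom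
    obtain ⟨t, rfl⟩ := hdom.exists_eq_some
    exact isTiling_central_of_isTiling_windowSystem hm hτ'

end Paper
end

section
/- Let T be a tile system in the von Neumann neighborhood N_vN, with finite set of glues X. There exist a finite glue set X_μ, a tile system T_μ in neighborhood N_vN over X_μ, a scale s ≥ 1, a polyomino assignment φ of scale s from T to finite T_μ-ribbons, and a zipper-simulation ψ of T by T_μ; in particular every (T,N_vN)-zipper is simulated by some T_μ-ribbon. -/
namespace Paper

open scoped Classical

theorem mem_Nvn_iff {w : Pos} :
    w ∈ Nvn ↔ w = (0, 1) ∨ w = (1, 0) ∨ w = (0, -1) ∨ w = (-1, 0) := by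
  simp [Nvn]

theorem neg_mem_Nvn {w : Pos} (hw : w ∈ Nvn) : -w ∈ Nvn := by
  rw [mem_Nvn_iff] at *
  rcases hw with rfl | rfl | rfl | rfl <;> simp

theorem ne_neg_of_mem_Nvn {w : Pos} (hw : w ∈ Nvn) : w ≠ -w := by
  rw [mem_Nvn_iff] at hw
  rcases hw with rfl | rfl | rfl | rfl <;> simp [Prod.ext_iff]

theorem finite_Nvn : Nvn.Finite := by
  unfold Nvn
  exact Set.toFinite _

instance : Finite {w : Pos // w ∈ Nvn} := finite_Nvn

theorem sc_add (s : ℤ) (u v : Pos) : sc s (u + v) = sc s u + sc s v := by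
  ext <;> simp [sc, mul_add]

theorem sc_injective {s : ℤ} (hs : 1 ≤ s) : Function.Injective (sc s) := by
  intro u v h
  have h1 := congrArg Prod.fst h
  have h2 := congrArg Prod.snd h
  simp only [sc] at h1 h2
  have hs' : s ≠ 0 := by omega
  exact Prod.ext (mul_left_cancel₀ hs' h1) (mul_left_cancel₀ hs' h2)

/-- The partial function with graph `G`. -/
noncomputable def graphFn {α : Type} (G : Pos → α → Prop) : Pos → Option α := fun p =>
  if h : ∃ a, G p a then some h.choose else none

theorem graphFn_eq_some {α : Type} {G : Pos → α → Prop}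
    (hG : ∀ p a b, G p a → G p b → a = b) {p : Pos} {a : α} :
    graphFn G p = some a ↔ G p a := by
  unfold graphFn
  split_ifs with h
  · simp only [Option.some.injEq]
    exact ⟨fun e => e ▸ h.choose_spec, fun ha => hG _ _ _ h.choose_spec ha⟩
  · simp only [false_iff]
    exact fun ha => h ⟨a, ha⟩

theorem graphFn_ne_none {α : Type} {G : Pos → α → Prop} {p : Pos} :
    graphFn G p ≠ none ↔ ∃ a, G p a := by
  unfold graphFn
  split_ifs with h <;> simp [h]

theorem IsInterval.const {I : Set ℤ} (hI : IsInterval I) {β : Type*} {f : ℤ → β}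
    (hf : ∀ i, i ∈ I → i + 1 ∈ I → f (i + 1) = f i) {i j : ℤ} (hi : i ∈ I) (hj : j ∈ I) :
    f i = f j := by
  have key : ∀ (n : ℕ) (a : ℤ), a ∈ I → a + n ∈ I → f (a + n) = f a := by
    intro n
    induction n with
    | zero => intro a _ _; simp
    | succ n ih =>
      intro a ha hn
      have hm : a + n ∈ I := hI a _ _ ha hn (by omega) (by push_cast; omega)
      have e : a + ((n + 1 : ℕ) : ℤ) = a + n + 1 := by push_cast; ring
      rw [e] at hn ⊢
      rw [hf _ hm hn, ih a ha hm]
  rcases le_total i j with h | h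
  · have := key (j - i).toNat i hi (by rwa [show i + ((j - i).toNat : ℤ) = j by omega])
    rw [show i + ((j - i).toNat : ℤ) = j by omega] at this
    exact this.symm
  · have := key (i - j).toNat j hj (by rwa [show j + ((i - j).toNat : ℤ) = i by omega])
    rwa [show j + ((i - j).toNat : ℤ) = i by omega] at this

/-- Macro-tiles simulating the tiles of `T` at scale `s`: each macro-tile `M` is a self-avoiding
path `c M 0, …, c M (n M - 1)`, possibly linked to a macro-tile before it (travelling in direction
`inDir M`) and to one after it (in direction `outDir M`), such that two placed macro-tiles are
disjoint exactly when the glues they simulate match. -/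
structure Scheme {X : Type} (T : Set (Tile X Nvn)) where
  Mac : Type
  mac_finite : Finite Mac
  lab : Mac → Tile X Nvn
  lab_mem : ∀ M, lab M ∈ T
  s : ℤ
  hs : 1 ≤ s
  n : Mac → ℕ
  c : Mac → ℕ → Pos
  inDir : Mac → Option Pos
  outDir : Mac → Option Pos
  /-- First cell of the macro-tiles entered in a given direction. -/
  port : Pos → Pos
  len : ℕ
  two_lt : ∀ M, 2 < n M
  n_le : ∀ M, n M ≤ len
  n_eq : ∀ M d, outDir M = some d → n M = len
  inj : ∀ M i j, i < n M → j < n M → c M i = c M j → i = j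
  adj : ∀ M i, i + 1 < n M → c M (i + 1) - c M i ∈ Nvn
  zero_mem : ∀ M, ∃ k < n M, c M k = (0, 0)
  head : ∀ M d, inDir M = some d → c M 0 = port d
  last : ∀ M d, outDir M = some d → c M (n M - 1) + d = sc s d + port d
  in_mem : ∀ M d, inDir M = some d → d ∈ Nvn
  out_mem : ∀ M d, outDir M = some d → d ∈ Nvn
  entry_free : ∀ M d, inDir M = some d → ∀ i < n M, c M i + d ≠ port d
  exit_free : ∀ M d, outDir M = some d → ∀ i < n M, c M i ≠ sc s d + port d
  exists_mac : ∀ t ∈ T, ∀ i o : Option Pos, (∀ d, i = some d → d ∈ Nvn) →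
    (∀ d, o = some d → d ∈ Nvn) → (∀ d, i = some d → o ≠ some (-d)) →
    ∃ M, lab M = t ∧ inDir M = i ∧ outDir M = o
  disjoint : ∀ M M' u u', u ≠ u' →
    (∀ (hw : u' - u ∈ Nvn) (hw' : -(u' - u) ∈ Nvn),
      lab M ⟨u' - u, hw⟩ = lab M' ⟨-(u' - u), hw'⟩) →
    ¬ (outDir M = some (u' - u) ∧ outDir M' = some (u - u')) →
    ∀ i < n M, ∀ j < n M', sc s u + c M i ≠ sc s u' + c M' j
  collide : ∀ M M' u w (hw : w ∈ Nvn) (hw' : -w ∈ Nvn),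
    lab M ⟨w, hw⟩ ≠ lab M' ⟨-w, hw'⟩ →
    ∃ i < n M, ∃ j < n M', sc s u + c M i = sc s (u + w) + c M' j

namespace Scheme

variable {X : Type} {T : Set (Tile X Nvn)} (S : Scheme T)

/-- Glues of the micro-tiles: links inside a macro-tile, links between consecutive macro-tiles,
and inert glues that match nothing. -/
abbrev Glue : Type :=
  (S.Mac × Fin (S.len + 1)) ⊕ {w : Pos // w ∈ Nvn} ⊕
    ({w : Pos // w ∈ Nvn} × S.Mac × Fin (S.len + 1))

/-- The `k`-th micro-tile of the macro-tile `M`. -/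
noncomputable def tile (M : S.Mac) (k : ℕ) : Tile S.Glue Nvn := fun w =>
  if k + 1 < S.n M ∧ S.c M (k + 1) = S.c M k + w.1 then .inl (M, Fin.ofNat _ k)
  else if k + 1 = S.n M ∧ S.outDir M = some w.1 then .inr (.inl w)
  else if 0 < k ∧ S.c M (k - 1) = S.c M k + w.1 then .inl (M, Fin.ofNat _ (k - 1))
  else if k = 0 ∧ S.inDir M = some (-w.1) then .inr (.inl ⟨-w.1, neg_mem_Nvn w.2⟩)
  else .inr (.inr (w, M, Fin.ofNat _ k))

/-- The micro-tiles. -/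
def tiles : Set (Tile S.Glue Nvn) := {a | ∃ M k, k < S.n M ∧ a = S.tile M k}

/-- The path continues from the `k`-th micro-tile of `M` in direction `w`. -/
def Out (M : S.Mac) (k : ℕ) (w : Pos) : Prop :=
  (k + 1 < S.n M ∧ S.c M (k + 1) = S.c M k + w) ∨ (k + 1 = S.n M ∧ S.outDir M = some w)

/-- The path enters the `k`-th micro-tile of `M` from its side `w`. -/
def In (M : S.Mac) (k : ℕ) (w : Pos) : Prop :=
  (0 < k ∧ S.c M (k - 1) = S.c M k + w) ∨ (k = 0 ∧ S.inDir M = some (-w))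

/-- The `k'`-th micro-tile of `M'` follows the `k`-th one of `M`, in direction `v`. -/
def Fwd (M : S.Mac) (k : ℕ) (M' : S.Mac) (k' : ℕ) (v : Pos) : Prop :=
  (k + 1 < S.n M ∧ M' = M ∧ k' = k + 1 ∧ S.c M (k + 1) = S.c M k + v) ∨
  (k + 1 = S.n M ∧ S.outDir M = some v ∧ k' = 0 ∧ S.inDir M' = some v)

variable {S}

theorem Out.unique {M : S.Mac} {k : ℕ} {w w' : Pos} (h : S.Out M k w) (h' : S.Out M k w') :
    w = w' := by
  rcases h with ⟨h1, h2⟩ | ⟨h1, h2⟩ <;> rcases h' with ⟨h3, h4⟩ | ⟨h3, h4⟩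
  · exact add_left_cancel (h2.symm.trans h4)
  · omega
  · omega
  · exact Option.some.inj (h2.symm.trans h4)

theorem In.unique {M : S.Mac} {k : ℕ} {w w' : Pos} (h : S.In M k w) (h' : S.In M k w') :
    w = w' := by
  rcases h with ⟨h1, h2⟩ | ⟨h1, h2⟩ <;> rcases h' with ⟨h3, h4⟩ | ⟨h3, h4⟩
  · exact add_left_cancel (h2.symm.trans h4)
  · omega
  · omega
  · exact neg_injective (Option.some.inj (h2.symm.trans h4))

theorem Out.not_in {M : S.Mac} {k : ℕ} {w : Pos} (hk : k < S.n M) (h : S.Out M k w) :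
    ¬ S.In M k w := by
  have h2n := S.two_lt M
  rintro (⟨h3, h4⟩ | ⟨rfl, h4⟩) <;> rcases h with ⟨h1, h2⟩ | ⟨h1, h2⟩
  · have := S.inj M (k - 1) (k + 1) (by omega) h1 (h4.trans h2.symm)
    omega
  · have hl := S.last M w h2
    rw [show S.n M - 1 = k by omega, ← h4] at hl
    exact S.exit_free M w h2 _ (by omega) hl
  · refine S.entry_free M _ h4 1 (by omega) ?_
    rw [← S.head M _ h4, h2]
    abel
  · omega

theorem ofNat_inj {k k' : ℕ} (hk : k ≤ S.len) (hk' : k' ≤ S.len)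
    (h : Fin.ofNat (S.len + 1) k = Fin.ofNat (S.len + 1) k') : k = k' := by
  have := congrArg Fin.val h
  rwa [Fin.val_ofNat, Fin.val_ofNat, Nat.mod_eq_of_lt (by omega),
    Nat.mod_eq_of_lt (by omega)] at this

theorem tile_cases (M : S.Mac) (k : ℕ) (w : Pos) (hw : w ∈ Nvn) :
    (k + 1 < S.n M ∧ S.c M (k + 1) = S.c M k + w ∧
      S.tile M k ⟨w, hw⟩ = .inl (M, Fin.ofNat _ k)) ∨
    (k + 1 = S.n M ∧ S.outDir M = some w ∧ S.tile M k ⟨w, hw⟩ = .inr (.inl ⟨w, hw⟩)) ∨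
    (0 < k ∧ S.c M (k - 1) = S.c M k + w ∧
      S.tile M k ⟨w, hw⟩ = .inl (M, Fin.ofNat _ (k - 1))) ∨
    (k = 0 ∧ S.inDir M = some (-w) ∧
      S.tile M k ⟨w, hw⟩ = .inr (.inl ⟨-w, neg_mem_Nvn hw⟩)) ∨
    (¬ S.Out M k w ∧ ¬ S.In M k w ∧
      S.tile M k ⟨w, hw⟩ = .inr (.inr (⟨w, hw⟩, M, Fin.ofNat _ k))) := by
  unfold tile Out In
  dsimp only
  split_ifs with h1 h2 h3 h4
  · exact .inl ⟨h1.1, h1.2, rfl⟩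
  · exact .inr (.inl ⟨h2.1, h2.2, rfl⟩)
  · exact .inr (.inr (.inl ⟨h3.1, h3.2, rfl⟩))
  · exact .inr (.inr (.inr (.inl ⟨h4.1, h4.2, rfl⟩)))
  · exact .inr (.inr (.inr (.inr ⟨by tauto, by tauto, rfl⟩)))

theorem tile_inert {M : S.Mac} {k : ℕ} {w : Pos} (hw : w ∈ Nvn) (h1 : ¬ S.Out M k w)
    (h2 : ¬ S.In M k w) : S.tile M k ⟨w, hw⟩ = .inr (.inr (⟨w, hw⟩, M, Fin.ofNat _ k)) := by
  unfold Out at h1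
  unfold In at h2
  unfold tile
  dsimp only
  rw [if_neg (by tauto), if_neg (by tauto), if_neg (by tauto), if_neg (by tauto)]

theorem exists_inert (M : S.Mac) (k : ℕ) : ∃ w ∈ Nvn, ¬ S.Out M k w ∧ ¬ S.In M k w := by
  by_contra! h
  have h' : ∀ w ∈ Nvn, S.Out M k w ∨ S.In M k w := fun w hw => by
    by_cases ho : S.Out M k w
    · exact .inl ho
    · exact .inr (h w hw ho)
  have a := h' (0, 1) (by simp [Nvn])
  have b := h' (1, 0) (by simp [Nvn])
  have c := h' (0, -1) (by simp [Nvn])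
  rcases a with a | a <;> rcases b with b | b <;> rcases c with c | c <;>
    first
    | simpa using a.unique b
    | simpa using a.unique c
    | simpa using b.unique c

theorem tile_inj {M M' : S.Mac} {k k' : ℕ} (hk : k < S.n M) (hk' : k' < S.n M')
    (h : S.tile M k = S.tile M' k') : M = M' ∧ k = k' := by
  obtain ⟨w, hw, h1, h2⟩ := exists_inert M k
  have e := congrFun h ⟨w, hw⟩
  rw [tile_inert hw h1 h2] at e
  have := S.n_le M
  have := S.n_le M'
  rcases tile_cases M' k' w hw with ⟨_, _, e'⟩ | ⟨_, _, e'⟩ | ⟨_, _, e'⟩ | ⟨_, _, e'⟩ |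
    ⟨_, _, e'⟩ <;> rw [e'] at e <;> simp only [reduceCtorEq, Sum.inr.injEq, Prod.mk.injEq] at e
  exact ⟨e.2.1, ofNat_inj (by omega) (by omega) e.2.2⟩

theorem Fwd.mem_Nvn {M M' : S.Mac} {k k' : ℕ} {v : Pos} (h : S.Fwd M k M' k' v) : v ∈ Nvn := by
  rcases h with ⟨h1, -, -, h2⟩ | ⟨-, h2, -⟩
  · have := S.adj M k h1
    rwa [h2, add_sub_cancel_left] at this
  · exact S.out_mem M v h2

theorem Fwd.dir_unique_right {M M' M₁ : S.Mac} {k k' k₁ : ℕ} {v v' : Pos}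
    (h : S.Fwd M k M' k' v) (h' : S.Fwd M₁ k₁ M' k' v') : v = v' := by
  rcases h with ⟨h1, rfl, rfl, h2⟩ | ⟨-, -, rfl, h2⟩ <;>
    rcases h' with ⟨h3, rfl, h5, h4⟩ | ⟨-, -, h5, h4⟩
  · obtain rfl : k = k₁ := by omega
    exact add_left_cancel (h2.symm.trans h4)
  · omega
  · omega
  · exact Option.some.inj (h2.symm.trans h4)

theorem Fwd.dir_unique_left {M M' M₁ : S.Mac} {k k' k₁ : ℕ} {v v' : Pos}
    (h : S.Fwd M k M' k' v) (h' : S.Fwd M k M₁ k₁ v') : v = v' := by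
  rcases h with ⟨h1, rfl, rfl, h2⟩ | ⟨_, h2, rfl, _⟩ <;>
    rcases h' with ⟨h3, rfl, h5, h4⟩ | ⟨_, h4, h5, _⟩
  · exact add_left_cancel (h2.symm.trans h4)
  · omega
  · omega
  · exact Option.some.inj (h2.symm.trans h4)

theorem Fwd.tile_eq {M M' : S.Mac} {k k' : ℕ} {v : Pos} (hk' : k' < S.n M')
    (h : S.Fwd M k M' k' v) (hv : v ∈ Nvn) (hv' : -v ∈ Nvn) :
    S.tile M k ⟨v, hv⟩ = S.tile M' k' ⟨-v, hv'⟩ := by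
  rcases h with ⟨h1, rfl, rfl, h2⟩ | ⟨h1, h2, rfl, h4⟩
  · have hin : S.In M' (k + 1) (-v) := .inl ⟨by omega, by rw [h2]; simp⟩
    rcases tile_cases M' (k + 1) (-v) hv' with ⟨a, b, _⟩ | ⟨a, b, _⟩ | ⟨_, _, e⟩ | ⟨a, _, _⟩ |
      ⟨_, a, _⟩
    · exact absurd hin (Out.not_in hk' (.inl ⟨a, b⟩))
    · exact absurd hin (Out.not_in hk' (.inr ⟨a, b⟩))
    · rw [e]
      simp [tile, h1, h2]
    · omega
    · exact absurd hin a
  · have hin : S.In M' 0 (-v) := .inr ⟨rfl, by simpa using h4⟩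
    have e1 : S.tile M k ⟨v, hv⟩ = .inr (.inl ⟨v, hv⟩) := by
      unfold tile
      dsimp only
      rw [if_neg (by omega), if_pos ⟨h1, h2⟩]
    rw [e1]
    rcases tile_cases M' 0 (-v) hv' with ⟨a, b, _⟩ | ⟨a, b, _⟩ | ⟨a, _⟩ | ⟨_, _, e⟩ |
      ⟨_, a, _⟩
    · exact absurd hin (Out.not_in hk' (.inl ⟨a, b⟩))
    · exact absurd hin (Out.not_in hk' (.inr ⟨a, b⟩))
    · omega
    · rw [e]
      simp
    · exact absurd hin a

theorem fwd_or_fwd_of_tile_eq {M M' : S.Mac} {k k' : ℕ} {v : Pos} (hk : k < S.n M)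
    (hk' : k' < S.n M') (hv : v ∈ Nvn) (hv' : -v ∈ Nvn)
    (h : S.tile M k ⟨v, hv⟩ = S.tile M' k' ⟨-v, hv'⟩) :
    S.Fwd M k M' k' v ∨ S.Fwd M' k' M k (-v) := by
  have hne := ne_neg_of_mem_Nvn hv
  have := S.n_le M
  have := S.n_le M'
  unfold Fwd
  rcases tile_cases M k v hv with ⟨a, b, e⟩ | ⟨a, b, e⟩ | ⟨a, b, e⟩ | ⟨a, b, e⟩ | ⟨_, _, e⟩ <;>
  rcases tile_cases M' k' (-v) hv' with ⟨a', b', e'⟩ | ⟨a', b', e'⟩ | ⟨a', b', e'⟩ |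
    ⟨a', b', e'⟩ | ⟨_, _, e'⟩ <;>
  rw [e, e'] at h <;>
  simp only [reduceCtorEq, Sum.inr.injEq, Sum.inl.injEq, Prod.mk.injEq, Subtype.mk.injEq,
    neg_neg] at h
  · obtain ⟨rfl, h⟩ := h
    obtain rfl := ofNat_inj (by omega) (by omega) h
    exact absurd (add_left_cancel (b.symm.trans b')) hne
  · obtain ⟨rfl, h⟩ := h
    obtain rfl := ofNat_inj (by omega) (by omega) h
    exact .inl (.inl ⟨a, rfl, by omega, b⟩)
  · exact absurd h hne
  · exact .inl (.inr ⟨a, b, a', by simpa using b'⟩)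
  · obtain ⟨rfl, h⟩ := h
    obtain rfl := ofNat_inj (by omega) (by omega) h
    exact .inr (.inl ⟨a', rfl, by omega, b'⟩)
  · obtain ⟨rfl, h⟩ := h
    obtain rfl : k = k' := by
      have := ofNat_inj (by omega) (by omega) h
      omega
    exact absurd (add_left_cancel (b.symm.trans b')) hne
  · exact .inr (.inr ⟨a', b', a, b⟩)
  · exact absurd h.symm hne
  · exact absurd h.1 hne

variable (S) in
/-- The tile map of the macro-tile `M`. -/
noncomputable def ribMap (M : S.Mac) : Pos → Option (Tile S.Glue Nvn) :=
  graphFn fun p a => ∃ k < S.n M, p = S.c M k ∧ a = S.tile M k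

theorem ribMap_eq_some {M : S.Mac} {p : Pos} {a : Tile S.Glue Nvn} :
    S.ribMap M p = some a ↔ ∃ k < S.n M, p = S.c M k ∧ a = S.tile M k := by
  refine graphFn_eq_some ?_
  rintro p a b ⟨k, hk, rfl, rfl⟩ ⟨k', hk', e, rfl⟩
  rw [S.inj M k k' hk hk' e]

theorem ribMap_c {M : S.Mac} {k : ℕ} (hk : k < S.n M) :
    S.ribMap M (S.c M k) = some (S.tile M k) := ribMap_eq_some.2 ⟨k, hk, rfl, rfl⟩

variable (S) in
/-- The ribbon of the macro-tile `M`. -/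
noncomputable def rib (M : S.Mac) : Ribbon S.Glue S.tiles where
  I := Set.Ico 0 (S.n M : ℤ)
  P i := S.c M i.toNat
  r := S.ribMap M
  isRibbon := by
    refine ⟨⟨⟨fun a b c ha hc h1 h2 => ⟨ha.1.trans h1, h2.trans_lt hc.2⟩, ?_⟩, ?_, ?_⟩, ?_, ?_⟩
    · rintro i ⟨h1, _⟩ ⟨_, h2⟩
      beta_reduce
      rw [show (i + 1).toNat = i.toNat + 1 by omega]
      exact S.adj M _ (by omega)
    · ext p
      simp only [tdom, Set.mem_ofPred_eq, ribMap, graphFn_ne_none, Set.mem_image, Set.mem_Ico]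
      constructor
      · rintro ⟨_, k, hk, rfl, _⟩
        exact ⟨k, by omega, by simp⟩
      · rintro ⟨i, hi, rfl⟩
        exact ⟨_, i.toNat, by omega, rfl, rfl⟩
    · intro p a h
      obtain ⟨k, hk, _, rfl⟩ := ribMap_eq_some.1 h
      exact ⟨M, k, hk, rfl⟩
    · rintro i ⟨hi, hi'⟩ j ⟨hj, hj'⟩ h
      have := S.inj M _ _ (by omega) (by omega) h
      omega
    · rintro i ⟨h1, h3⟩ ⟨_, h2⟩ t t' ht ht' hv hv'
      beta_reduce at ht ht' hv hv' ⊢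
      have e : (i + 1).toNat = i.toNat + 1 := by omega
      simp only [e] at ht' hv hv' ⊢
      rw [ribMap_c (by omega), Option.some.injEq] at ht ht'
      subst ht ht'
      refine Fwd.tile_eq (by omega) (.inl ⟨by omega, rfl, rfl, ?_⟩) hv hv'
      abel

theorem rib_r (M : S.Mac) : (S.rib M).r = S.ribMap M := rfl

theorem rib_inj {M M' : S.Mac} (h : S.rib M = S.rib M') : M = M' := by
  obtain ⟨k, hk, -⟩ := S.zero_mem M
  have h1 : S.ribMap M' (S.c M k) = some (S.tile M k) := by
    rw [← rib_r, ← h]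
    exact ribMap_c hk
  obtain ⟨k', hk', -, e⟩ := ribMap_eq_some.1 h1
  exact (tile_inj hk hk' e).1

theorem rib_finite (M : S.Mac) : (S.rib M).I.Finite ∧ (S.rib M).I.Nonempty := by
  have := S.two_lt M
  exact ⟨Set.finite_Ico _ _, ⟨0, by simp only [rib, Set.mem_Ico]; omega⟩⟩

/-- A complete copy of the macro-tile `M` at grid position `u` occurs in `r`. -/
def Complete (r : Pos → Option (Tile S.Glue Nvn)) (M : S.Mac) (u : Pos) : Prop :=
  ∀ k < S.n M, r (sc S.s u + S.c M k) = some (S.tile M k)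

theorem complete_iff {r : Pos → Option (Tile S.Glue Nvn)} {M : S.Mac} {u : Pos} :
    Complete r M u ↔ ∀ p a, S.ribMap M p = some a → r (sc S.s u + p) = some a := by
  constructor
  · intro h p a hp
    obtain ⟨k, hk, rfl, rfl⟩ := ribMap_eq_some.1 hp
    exact h k hk
  · intro h k hk
    exact h _ _ (ribMap_c hk)

theorem Complete.overlap {r : Pos → Option (Tile S.Glue Nvn)} {M M' : S.Mac} {u u' : Pos}
    (h : Complete r M u) (h' : Complete r M' u') {k k' : ℕ} (hk : k < S.n M) (hk' : k' < S.n M')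
    (e : sc S.s u + S.c M k = sc S.s u' + S.c M' k') : u = u' ∧ M = M' := by
  have h1 := h k hk
  rw [e, h' k' hk', Option.some.injEq] at h1
  obtain ⟨rfl, rfl⟩ := tile_inj hk' hk h1
  exact ⟨sc_injective S.hs (add_right_cancel e), rfl⟩

theorem Complete.unique {r : Pos → Option (Tile S.Glue Nvn)} {M M' : S.Mac} {u : Pos}
    (h : Complete r M u) (h' : Complete r M' u) : M = M' := by
  obtain ⟨k, hk, e⟩ := S.zero_mem M
  obtain ⟨k', hk', e'⟩ := S.zero_mem M'
  exact (h.overlap h' hk hk' (by rw [e, e'])).2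

/-- The poly-ribbon of the complete macro-tiles occurring in `r`. -/
noncomputable def trim (r : Pos → Option (Tile S.Glue Nvn)) :
    Pos → Option (Ribbon S.Glue S.tiles) :=
  graphFn fun u R => ∃ M, R = S.rib M ∧ Complete r M u

theorem trim_eq_some {r : Pos → Option (Tile S.Glue Nvn)} {u : Pos}
    {R : Ribbon S.Glue S.tiles} :
    trim r u = some R ↔ ∃ M, R = S.rib M ∧ Complete r M u := by
  refine graphFn_eq_some ?_
  rintro u R R' ⟨M, rfl, h⟩ ⟨M', rfl, h'⟩
  rw [h.unique h']

theorem trim_ne_none {r : Pos → Option (Tile S.Glue Nvn)} {u : Pos} :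
    trim r u ≠ none ↔ ∃ M, Complete r M u := by
  rw [trim, graphFn_ne_none]
  exact ⟨fun ⟨_, M, _, h⟩ => ⟨M, h⟩, fun ⟨M, h⟩ => ⟨_, M, rfl, h⟩⟩

/-- A sequence of macro-tiles, disjoint and consecutively linked, is a poly-ribbon. -/
theorem isPolyRibbon_of_macros {J : Set ℤ} {Q : ℤ → Pos} {M : ℤ → S.Mac}
    {ρ : Pos → Option (Ribbon S.Glue S.tiles)} (hJ : IsInterval J)
    (hinj : ∀ i ∈ J, ∀ j ∈ J, Q i = Q j → i = j)
    (hρ : ∀ u R, ρ u = some R ↔ ∃ j ∈ J, u = Q j ∧ R = S.rib (M j))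
    (hdisj : ∀ i ∈ J, ∀ j ∈ J, i ≠ j → ∀ k < S.n (M i), ∀ k' < S.n (M j),
      sc S.s (Q i) + S.c (M i) k ≠ sc S.s (Q j) + S.c (M j) k')
    (hlink : ∀ j, j ∈ J → j + 1 ∈ J → ∃ v, Q (j + 1) = Q j + v ∧
      S.outDir (M j) = some v ∧ S.inDir (M (j + 1)) = some v) :
    IsPolyRibbon S.s J Q ρ := by
  refine ⟨⟨hJ, ?_⟩, hinj, ?_, ?_, ?_, ?_⟩
  · intro j h1 h2
    obtain ⟨v, e, ho, -⟩ := hlink j h1 h2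
    rw [e, add_sub_cancel_left]
    exact S.out_mem _ _ ho
  · ext u
    simp only [tdom, Set.mem_ofPred_eq, Option.ne_none_iff_exists', hρ, Set.mem_image]
    constructor
    · rintro ⟨_, j, hj, rfl, _⟩
      exact ⟨j, hj, rfl⟩
    · rintro ⟨j, hj, rfl⟩
      exact ⟨_, j, hj, rfl, rfl⟩
  · intro u R h
    obtain ⟨j, _, _, rfl⟩ := (hρ u R).1 h
    exact rib_finite _
  · intro u v R R' huv hu hv p hp q hq
    obtain ⟨i, hi, rfl, rfl⟩ := (hρ _ _).1 hu
    obtain ⟨j, hj, rfl, rfl⟩ := (hρ _ _).1 hv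
    obtain ⟨a, ha⟩ := Option.ne_none_iff_exists'.1 hp
    obtain ⟨b, hb⟩ := Option.ne_none_iff_exists'.1 hq
    obtain ⟨k, hk, rfl, -⟩ := ribMap_eq_some.1 ha
    obtain ⟨k', hk', rfl, -⟩ := ribMap_eq_some.1 hb
    exact hdisj i hi j hj (fun e => huv (by rw [e])) k hk k' hk'
  · intro j h1 h2 R₁ R₂ hR₁ hR₂ m₁ hm₁ m₂ hm₂
    obtain ⟨i, hi, e, rfl⟩ := (hρ _ _).1 hR₁
    obtain rfl := hinj _ h1 _ hi e
    obtain ⟨i', hi', e', rfl⟩ := (hρ _ _).1 hR₂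
    obtain rfl := hinj _ h2 _ hi' e'
    obtain ⟨v, e, ho, hin⟩ := hlink _ h1 h2
    have hn := S.two_lt (M j)
    have hn' := S.two_lt (M (j + 1))
    have em₁ : m₁ = (S.n (M j) - 1 : ℕ) := by
      refine hm₁.unique ⟨?_, fun x hx => ?_⟩
      · simp only [rib, Set.mem_Ico]; omega
      · simp only [rib, Set.mem_Ico] at hx; omega
    have em₂ : m₂ = (0 : ℕ) := by
      refine hm₂.unique ⟨?_, fun x hx => ?_⟩
      · simp only [rib, Set.mem_Ico]; omega
      · simp only [rib, Set.mem_Ico] at hx; omega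
    have P₁ : (S.rib (M j)).P m₁ = S.c (M j) (S.n (M j) - 1) := by
      rw [em₁]; simp only [rib, Int.toNat_natCast]
    have P₂ : (S.rib (M (j + 1))).P m₂ = S.c (M (j + 1)) 0 := by
      rw [em₂]; simp only [rib, Int.toNat_natCast]
    have hv : sc S.s (Q (j + 1)) + (S.rib (M (j + 1))).P m₂ -
        (sc S.s (Q j) + (S.rib (M j)).P m₁) = v := by
      rw [P₁, P₂, S.head _ _ hin, e, sc_add, add_assoc, ← S.last _ _ ho]
      abel
    rw [P₁, P₂] at *
    rw [hv]
    refine ⟨S.out_mem _ _ ho, fun t₁ t₂ ht₁ ht₂ hw hw' => ?_⟩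
    rw [rib_r, ribMap_c (by omega), Option.some.injEq] at ht₁ ht₂
    subst ht₁ ht₂
    exact Fwd.tile_eq (by omega) (.inr ⟨by omega, ho, rfl, hin⟩) hw hw'

theorem isPolyRibbon_empty {Q : ℤ → Pos} {ρ : Pos → Option (Ribbon S.Glue S.tiles)}
    (hρ : ∀ u, ρ u = none) : IsPolyRibbon S.s ∅ Q ρ := by
  refine ⟨⟨fun a b c ha => ha.elim, fun i hi => hi.elim⟩, fun i hi => hi.elim, ?_, ?_, ?_,
    fun i hi => hi.elim⟩
  · ext u
    simp [tdom, hρ]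
  · intro u R h
    simp [hρ] at h
  · intro u v R R' _ h
    simp [hρ] at h

theorem IsRibbon.reverse {Y : Type} {U : Set (Tile Y Nvn)} {I : Set ℤ} {P : ℤ → Pos}
    {r : Pos → Option (Tile Y Nvn)} (h : IsRibbon U I P r) :
    IsRibbon U {i | -i ∈ I} (fun i => P (-i)) r := by
  obtain ⟨⟨⟨hI, hadj⟩, hdom, hmem⟩, hinj, hst⟩ := h
  refine ⟨⟨⟨fun a b c ha hc h1 h2 => hI (-c) (-b) (-a) hc ha (by omega) (by omega), ?_⟩, ?_, hmem⟩,
    fun i hi j hj e => neg_injective (hinj _ hi _ hj e), ?_⟩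
  · intro i h1 h2
    have h2' : -(i + 1) ∈ I := h2
    have e : -(i + 1) + 1 = -i := by ring
    have := neg_mem_Nvn (hadj (-(i + 1)) h2 (by rw [e]; exact h1))
    rwa [e, neg_sub] at this
  · rw [hdom]
    ext p
    simp only [Set.mem_image, Set.mem_ofPred_eq]
    exact ⟨fun ⟨i, hi, e⟩ => ⟨-i, by simpa using hi, by simpa using e⟩,
      fun ⟨i, hi, e⟩ => ⟨-i, hi, e⟩⟩
  · intro i h1 h2 t t' ht ht' hv hv'
    have e : -(i + 1) + 1 = -i := by ring
    have key := hst (-(i + 1)) h2 (by rw [e]; exact h1) t' t ht' (by rw [e]; exact ht)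
    rw [e] at key
    have hneg : P (-i) - P (-(i + 1)) = -(P (-(i + 1)) - P (-i)) := by abel
    have := key (by rw [hneg]; exact hv') (by rw [hneg, neg_neg]; exact hv)
    simp only [neg_sub] at this ⊢
    exact this.symm

/-- Every ribbon of micro-tiles can be read along the direction of its macro-tiles. -/
theorem exists_forward (I : Set ℤ) (P : ℤ → Pos) (r : Pos → Option (Tile S.Glue Nvn))
    (h : IsRibbon S.tiles I P r) (hne : I.Nonempty) :
    ∃ (I' : Set ℤ) (P' : ℤ → Pos) (M : ℤ → S.Mac) (κ : ℤ → ℕ), IsRibbon S.tiles I' P' r ∧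
      (∀ i ∈ I', κ i < S.n (M i) ∧ r (P' i) = some (S.tile (M i) (κ i))) ∧
      ∀ i, i ∈ I' → i + 1 ∈ I' →
        S.Fwd (M i) (κ i) (M (i + 1)) (κ (i + 1)) (P' (i + 1) - P' i) := by
  have hr := h
  obtain ⟨⟨⟨hI, hadj⟩, hdom, hmem⟩, hinj, hst⟩ := h
  have hex : ∀ i ∈ I, ∃ M k, k < S.n M ∧ r (P i) = some (S.tile M k) := by
    intro i hi
    have : P i ∈ tdom r := hdom ▸ ⟨i, hi, rfl⟩
    obtain ⟨a, ha⟩ := Option.ne_none_iff_exists'.1 this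
    obtain ⟨M, k, hk, rfl⟩ := hmem _ _ ha
    exact ⟨M, k, hk, ha⟩
  obtain ⟨i₀, hi₀⟩ := hne
  have : Nonempty S.Mac := ⟨(hex i₀ hi₀).choose⟩
  choose! M κ hκ using hex
  have hor : ∀ i, i ∈ I → i + 1 ∈ I →
      S.Fwd (M i) (κ i) (M (i + 1)) (κ (i + 1)) (P (i + 1) - P i) ∨
      S.Fwd (M (i + 1)) (κ (i + 1)) (M i) (κ i) (P i - P (i + 1)) := by
    intro i h1 h2
    have hv := hadj i h1 h2
    have := fwd_or_fwd_of_tile_eq (hκ i h1).1 (hκ _ h2).1 hv (neg_mem_Nvn hv)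
      (hst i h1 h2 _ _ (hκ i h1).2 (hκ _ h2).2 hv (neg_mem_Nvn hv))
    rwa [neg_sub] at this
  by_cases hall : ∀ i, i ∈ I → i + 1 ∈ I →
      S.Fwd (M i) (κ i) (M (i + 1)) (κ (i + 1)) (P (i + 1) - P i)
  · exact ⟨I, P, M, κ, hr, hκ, hall⟩
  push Not at hall
  obtain ⟨j, hj, hj', hnf⟩ := hall
  have h_succ : ∀ i, i ∈ I → i + 1 ∈ I → i + 1 + 1 ∈ I →
      (S.Fwd (M i) (κ i) (M (i + 1)) (κ (i + 1)) (P (i + 1) - P i) ↔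
      S.Fwd (M (i + 1)) (κ (i + 1)) (M (i + 1 + 1)) (κ (i + 1 + 1)) (P (i + 1 + 1) - P (i + 1))) := by
    intro i h0 h1 h2
    have hne : P (i + 1 + 1) ≠ P i := fun e => by
      have := hinj _ h2 _ h0 e
      omega
    constructor
    · intro hf
      refine (hor _ h1 h2).resolve_right fun hb => hne ?_
      have := hf.dir_unique_right hb
      rw [sub_right_inj] at this
      exact this.symm
    · intro hf
      refine (hor _ h0 h1).resolve_right fun hb => hne ?_
      have := hf.dir_unique_left hb
      rwa [sub_left_inj] at this
  have hback : ∀ i, i ∈ I → i + 1 ∈ I →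
      S.Fwd (M (i + 1)) (κ (i + 1)) (M i) (κ i) (P i - P (i + 1)) := by
    intro i h1 h2
    refine (hor i h1 h2).resolve_left fun hf => hnf ?_
    have hint : IsInterval {i | i ∈ I ∧ i + 1 ∈ I} := fun a b c ha hc h1 h2 =>
      ⟨hI a b c ha.1 hc.1 h1 h2, hI a _ (c + 1) ha.1 hc.2 (by omega) (by omega)⟩
    have := hint.const
      (f := fun i => S.Fwd (M i) (κ i) (M (i + 1)) (κ (i + 1)) (P (i + 1) - P i))
      (fun i ha hb => propext (h_succ i ha.1 ha.2 hb.2).symm) ⟨h1, h2⟩ ⟨hj, hj'⟩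
    exact this.mp hf
  refine ⟨_, _, fun i => M (-i), fun i => κ (-i), IsRibbon.reverse hr, fun i hi => hκ _ hi, ?_⟩
  intro i h1 h2
  have e : -(i + 1) + 1 = -i := by ring
  have := hback (-(i + 1)) h2 (by rw [e]; exact h1)
  rwa [e] at this

/-- The complete macro-tiles of a ribbon of micro-tiles form a poly-ribbon. -/
theorem exists_isPolyRibbon_trim (R : Ribbon S.Glue S.tiles) :
    ∃ J Q, IsPolyRibbon S.s J Q (trim R.r) := by
  by_cases hD : ∀ M u, ¬ Complete R.r M u
  · refine ⟨∅, fun _ => 0, isPolyRibbon_empty fun u => ?_⟩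
    by_contra h
    obtain ⟨M, hM⟩ := trim_ne_none.1 h
    exact hD M u hM
  push Not at hD
  obtain ⟨M₀, u₀, hM₀⟩ := hD
  have hn₀ := S.two_lt M₀
  obtain ⟨I, P, M, κ, ⟨⟨⟨hI, hadj⟩, hdom, hmem⟩, hinj, -⟩, hκ, hfwd⟩ :=
    exists_forward R.I R.P R.r R.isRibbon (by
      by_contra hne
      rw [Set.not_nonempty_iff_eq_empty] at hne
      have h1 := R.isRibbon.1.2.1
      rw [hne, Set.image_empty] at h1
      have : sc S.s u₀ + S.c M₀ 0 ∈ tdom R.r := by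
        simp [tdom, hM₀ 0 (by omega)]
      rw [h1] at this
      exact this)
  set r := R.r with hr
  -- the first micro-tile of a complete macro-tile
  have hfirst : ∀ M' u, Complete r M' u → ∃ i ∈ I, P i = sc S.s u + S.c M' 0 ∧ M i = M' ∧ κ i = 0 := by
    intro M' u h
    have h2n := S.two_lt M'
    have h0 := h 0 (by omega)
    have : sc S.s u + S.c M' 0 ∈ tdom r := by simp [tdom, h0]
    rw [hdom] at this
    obtain ⟨i, hi, e⟩ := this
    have h1 := (hκ i hi).2
    rw [e, h0, Option.some.injEq] at h1
    obtain ⟨rfl, h2⟩ := tile_inj (by omega) (hκ i hi).1 h1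
    exact ⟨i, hi, e, rfl, h2.symm⟩
  obtain ⟨i₀, hi₀, hP₀, rfl, hκ₀⟩ := hfirst _ _ hM₀
  have hlen : 2 < S.len := hn₀.trans_le (S.n_le _)
  have hres : ∀ i ∈ I, ((κ i : ℤ) - i) % S.len = (0 - i₀) % S.len := by
    intro i hi
    have := hI.const (f := fun i => ((κ i : ℤ) - i) % S.len) (fun i h1 h2 => ?_) hi hi₀
    · simpa [hκ₀] using this
    · rcases hfwd i h1 h2 with ⟨-, -, e, -⟩ | ⟨e, ho, e', -⟩
      · rw [e]
        congr 1
        push_cast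
        ring
      · have := S.n_eq _ _ ho
        rw [e', ← Int.add_emod_right]
        congr 1
        push_cast
        have : ((κ i : ℤ)) + 1 = S.len := by exact_mod_cast e.trans this
        linarith
  have hseg : ∀ i ∈ I, κ i = 0 → ∀ k : ℕ, k < S.n (M i) → i + k ∈ I →
      M (i + k) = M i ∧ κ (i + k) = k ∧ P (i + k) = P i - S.c (M i) 0 + S.c (M i) k := by
    intro i hi h0 k
    induction k with
    | zero => intro _ _; simp [h0]
    | succ k ih =>
      intro hk hik
      have hik' : i + k ∈ I := hI i _ _ hi hik (by omega) (by push_cast; omega)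
      obtain ⟨e1, e2, e3⟩ := ih (by omega) hik'
      rw [show i + ((k + 1 : ℕ) : ℤ) = i + k + 1 by push_cast; ring] at hik ⊢
      rcases hfwd _ hik' hik with ⟨-, e4, e5, e6⟩ | ⟨e4, -⟩
      · rw [e1, e2] at e6
        refine ⟨e4.trans e1, by omega, ?_⟩
        rw [e6, e3]
        abel
      · rw [e1] at e4
        omega
  have hnext : ∀ i ∈ I, κ i = 0 → i + S.len ∈ I → S.n (M i) = S.len ∧
      ∃ v, S.outDir (M i) = some v ∧ S.inDir (M (i + S.len)) = some v ∧
        P (i + S.len) - S.c (M (i + S.len)) 0 = P i - S.c (M i) 0 + sc S.s v := by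
    intro i hi h0 hil
    have hn := S.n_le (M i)
    have h2n := S.two_lt (M i)
    have h1 : i + ((S.n (M i) - 1 : ℕ) : ℤ) ∈ I := hI i _ _ hi hil (by omega) (by omega)
    have e : i + ((S.n (M i) - 1 : ℕ) : ℤ) + 1 = i + S.n (M i) := by omega
    have h2 : i + ((S.n (M i) - 1 : ℕ) : ℤ) + 1 ∈ I :=
      hI i _ _ hi hil (by omega) (by omega)
    obtain ⟨e1, e2, e3⟩ := hseg i hi h0 _ (by omega) h1
    rcases hfwd _ h1 h2 with ⟨e4, -⟩ | ⟨-, ho, -, hin⟩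
    · rw [e1, e2] at e4
      omega
    · rw [e1] at ho
      have hnl := S.n_eq _ _ ho
      have el : i + (S.n (M i) : ℤ) = i + S.len := by rw [hnl]
      obtain ⟨v, hv⟩ : ∃ v, v = P (i + ((S.n (M i) - 1 : ℕ) : ℤ) + 1) -
        P (i + ((S.n (M i) - 1 : ℕ) : ℤ)) := ⟨_, rfl⟩
      rw [← hv] at ho hin
      rw [e, el] at hv hin
      rw [e3] at hv
      refine ⟨hnl, v, ho, hin, ?_⟩
      rw [S.head _ _ hin]
      linear_combination S.last _ _ ho - hv
  have hκ0 : ∀ j : ℤ, i₀ + S.len * j ∈ I → κ (i₀ + S.len * j) = 0 := by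
    intro j hj
    have h1 := hres _ hj
    have h2 := (hκ _ hj).1
    have h3 := S.n_le (M (i₀ + S.len * j))
    have h4 : (κ (i₀ + S.len * j) : ℤ) % S.len = 0 := by
      have e : ((κ (i₀ + S.len * j) : ℤ)) =
        (κ (i₀ + S.len * j) : ℤ) - (i₀ + S.len * j) - (0 - i₀) + S.len * j := by ring
      rw [e, Int.add_mul_emod_self_left]
      exact Int.emod_eq_zero_of_dvd (Int.ModEq.dvd h1.symm)
    rw [Int.emod_eq_of_lt (by omega) (by omega)] at h4
    exact_mod_cast h4
  have hA : IsInterval {j : ℤ | i₀ + S.len * j ∈ I} := fun a b c ha hc h1 h2 =>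
    hI _ _ _ ha hc (by nlinarith) (by nlinarith)
  have hsucc : ∀ j : ℤ, i₀ + S.len * (j + 1) = i₀ + S.len * j + S.len := fun j => by ring
  have hQ : ∀ j : ℤ, i₀ + S.len * j ∈ I →
      ∃ q, P (i₀ + S.len * j) - S.c (M (i₀ + S.len * j)) 0 = sc S.s q := by
    intro j hj
    have := hA.const (f := fun j => ∃ q, P (i₀ + S.len * j) - S.c (M (i₀ + S.len * j)) 0 = sc S.s q)
      (i := 0) (j := j) (fun j h1 h2 => ?_) (by simpa using hi₀) hj
    · refine this.mp ⟨u₀, ?_⟩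
      rw [mul_zero, add_zero, hP₀, add_sub_cancel_right]
    · beta_reduce at h1 h2 ⊢
      simp only [Set.mem_ofPred_eq] at h1 h2
      rw [hsucc] at h2 ⊢
      obtain ⟨-, v, -, -, e⟩ := hnext _ h1 (hκ0 j h1) h2
      rw [e]
      refine propext ⟨fun ⟨q, h⟩ => ⟨q - v, ?_⟩, fun ⟨q, h⟩ => ⟨q + v, by rw [h, sc_add]⟩⟩
      have := sc_add S.s (q - v) v
      rw [sub_add_cancel] at this
      linear_combination h + this
  choose! Q hQ using hQ
  have hcomp : ∀ j : ℤ, i₀ + S.len * j ∈ I → i₀ + S.len * (j + 1) ∈ I →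
      Complete r (M (i₀ + S.len * j)) (Q j) := by
    intro j h1 h2 k hk
    rw [hsucc] at h2
    have hn := S.n_le (M (i₀ + S.len * j))
    have h3 : i₀ + S.len * j + (k : ℤ) ∈ I := hI _ _ _ h1 h2 (by omega) (by omega)
    obtain ⟨e1, e2, e3⟩ := hseg _ h1 (hκ0 j h1) k hk h3
    have := (hκ _ h3).2
    rwa [e1, e2, e3, hQ j h1] at this
  refine ⟨{j | i₀ + S.len * j ∈ I ∧ Complete r (M (i₀ + S.len * j)) (Q j)}, Q,
    isPolyRibbon_of_macros (M := fun j => M (i₀ + S.len * j)) ?_ ?_ ?_ ?_ ?_⟩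
  · rintro a b c ⟨ha, -⟩ ⟨hc, hc'⟩ h1 h2
    have hb := hA a b c ha hc h1 h2
    rcases h2.eq_or_lt with rfl | h2
    · exact ⟨hc, hc'⟩
    · exact ⟨hb, hcomp b hb (hA b _ c hb hc (by omega) (by omega))⟩
  · rintro i ⟨h1, h1'⟩ j ⟨h2, h2'⟩ e
    rw [e] at h1'
    have hM := h1'.unique h2'
    have a := hQ i h1
    have b := hQ j h2
    rw [e, hM] at a
    have := hinj _ h1 _ h2 (by linear_combination a - b)
    have : (S.len : ℤ) * i = S.len * j := by linarith
    exact mul_left_cancel₀ (by omega) this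
  · intro u R'
    rw [trim_eq_some]
    constructor
    · rintro ⟨M', rfl, h⟩
      obtain ⟨i, hi, hP, rfl, h0⟩ := hfirst _ _ h
      have h1 := hres i hi
      rw [h0] at h1
      obtain ⟨j, hj⟩ := Int.ModEq.dvd h1.symm
      obtain rfl : i = i₀ + S.len * (-j) := by
        push_cast at hj
        linarith
      have hq := hQ _ hi
      rw [hP, add_sub_cancel_right] at hq
      have hq := sc_injective S.hs hq
      exact ⟨-j, ⟨hi, hq ▸ h⟩, hq, rfl⟩
    · rintro ⟨j, ⟨_, h⟩, rfl, rfl⟩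
      exact ⟨_, rfl, h⟩
  · rintro i ⟨h1, h1'⟩ j ⟨h2, h2'⟩ hij k hk k' hk' e
    obtain ⟨e1, e2⟩ := h1'.overlap h2' hk hk' e
    have a := hQ i h1
    have b := hQ j h2
    rw [e1, e2] at a
    have := hinj _ h1 _ h2 (by linear_combination a - b)
    have : (S.len : ℤ) * i = S.len * j := by linarith
    exact hij (mul_left_cancel₀ (by omega) this)
  · rintro j ⟨h1, -⟩ ⟨h2, -⟩
    have a := hQ j h1
    have b := hQ (j + 1) h2
    rw [hsucc] at h2 b ⊢
    obtain ⟨-, v, ho, hin, e⟩ := hnext _ h1 (hκ0 j h1) h2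
    refine ⟨v, sc_injective S.hs ?_, ho, hin⟩
    rw [sc_add]
    linear_combination e - b + a

/-- The two paths agree up to a translation of the indices. -/
def Shift (I : Set ℤ) (P : ℤ → Pos) (I' : Set ℤ) (P' : ℤ → Pos) : Prop :=
  ∃ d : ℤ, (∀ i, i ∈ I ↔ i + d ∈ I') ∧ ∀ i ∈ I, P' (i + d) = P i

/-- A sequence of pairwise disjoint macro-tiles, linked exactly as the path `P` prescribes. -/
structure Chain (I : Set ℤ) (P : ℤ → Pos) (M : ℤ → S.Mac) : Prop where
  interval : IsInterval I
  inj : ∀ i ∈ I, ∀ j ∈ I, P i = P j → i = j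
  disj : ∀ i ∈ I, ∀ j ∈ I, i ≠ j → ∀ k < S.n (M i), ∀ k' < S.n (M j),
    sc S.s (P i) + S.c (M i) k ≠ sc S.s (P j) + S.c (M j) k'
  link : ∀ j, j ∈ I → j + 1 ∈ I → S.outDir (M j) = some (P (j + 1) - P j) ∧
    S.inDir (M (j + 1)) = some (P (j + 1) - P j)
  finish : ∀ j ∈ I, S.outDir (M j) ≠ none → j + 1 ∈ I

namespace Chain

variable {I : Set ℤ} {P : ℤ → Pos} {M : ℤ → S.Mac}

theorem isPolyRibbon (h : Chain I P M) {ρ : Pos → Option (Ribbon S.Glue S.tiles)}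
    (hρ : ∀ u R, ρ u = some R ↔ ∃ j ∈ I, u = P j ∧ R = S.rib (M j)) :
    IsPolyRibbon S.s I P ρ := by
  refine isPolyRibbon_of_macros h.interval h.inj hρ h.disj fun j h1 h2 => ?_
  obtain ⟨ho, hin⟩ := h.link j h1 h2
  exact ⟨_, by abel, ho, hin⟩

theorem shift_of_isPolyRibbon (h : Chain I P M) {ρ : Pos → Option (Ribbon S.Glue S.tiles)}
    (hρ : ∀ u R, ρ u = some R ↔ ∃ j ∈ I, u = P j ∧ R = S.rib (M j)) {I' : Set ℤ}
    {P' : ℤ → Pos} (h' : IsPolyRibbon S.s I' P' ρ) : Shift I P I' P' := by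
  have hdom : P '' I = P' '' I' := (h.isPolyRibbon hρ).2.2.1.symm.trans h'.2.2.1
  have hσ : ∀ i ∈ I', ∃ j ∈ I, P j = P' i := by
    intro i hi
    have : P' i ∈ P '' I := hdom ▸ ⟨i, hi, rfl⟩
    exact this
  choose! σ hσI hσ using hσ
  have h_succ : ∀ i, i ∈ I' → i + 1 ∈ I' → σ (i + 1) = σ i + 1 := by
    intro i h1 h2
    have hn := S.two_lt (M (σ i))
    have hn' := S.two_lt (M (σ (i + 1)))
    obtain ⟨hv, ht⟩ := h'.2.2.2.2.2 i h1 h2 (S.rib (M (σ i))) (S.rib (M (σ (i + 1))))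
      ((hρ _ _).2 ⟨_, hσI i h1, (hσ i h1).symm, rfl⟩)
      ((hρ _ _).2 ⟨_, hσI _ h2, (hσ _ h2).symm, rfl⟩)
      (S.n (M (σ i)) - 1 : ℕ)
      ⟨by simp only [rib, Set.mem_Ico]; omega,
        fun x hx => by simp only [rib, Set.mem_Ico] at hx; omega⟩
      (0 : ℕ)
      ⟨by simp only [rib, Set.mem_Ico]; omega,
        fun x hx => by simp only [rib, Set.mem_Ico] at hx; omega⟩
    simp only [rib, Int.toNat_natCast] at hv ht
    have ht := ht _ _ (ribMap_c (by omega)) (ribMap_c (by omega)) hv (neg_mem_Nvn hv)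
    obtain ⟨v, e⟩ : ∃ v, v = sc S.s (P' (i + 1)) + S.c (M (σ (i + 1))) 0 -
      (sc S.s (P' i) + S.c (M (σ i)) (S.n (M (σ i)) - 1)) := ⟨_, rfl⟩
    rcases fwd_or_fwd_of_tile_eq (by omega) (by omega) hv (neg_mem_Nvn hv) ht with
      (⟨_, _⟩ | ⟨-, ho, -, hin⟩) | (⟨_, _, _, _⟩ | ⟨_, _⟩)
    · omega
    · rw [← e] at ho hin
      have hf := h.finish _ (hσI i h1) (by rw [ho]; simp)
      have hl := (h.link _ (hσI i h1) hf).1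
      rw [ho, Option.some.injEq] at hl
      have e1 : P' (i + 1) = P' i + v := by
        apply sc_injective S.hs
        rw [sc_add]
        have a := S.last _ _ ho
        rw [S.head _ _ hin] at e
        linear_combination a - e
      refine h.inj _ (hσI _ h2) _ hf ?_
      rw [hσ _ h2, e1, ← hσ i h1, hl]
      abel
    · omega
    · omega
  rcases I'.eq_empty_or_nonempty with rfl | ⟨i₀, hi₀⟩
  · rw [Set.image_empty, Set.image_eq_empty] at hdom
    subst hdom
    exact ⟨0, fun i => Iff.rfl, fun i hi => hi.elim⟩
  have hconst : ∀ i ∈ I', σ i = i - (i₀ - σ i₀) := by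
    intro i hi
    have := h'.1.1.const (f := fun i => σ i - i)
      (fun i h1 h2 => by rw [h_succ i h1 h2]; ring) hi hi₀
    beta_reduce at this
    omega
  have hI : ∀ i ∈ I, i + (i₀ - σ i₀) ∈ I' ∧ P' (i + (i₀ - σ i₀)) = P i := by
    intro i hi
    have : P i ∈ P' '' I' := hdom ▸ ⟨i, hi, rfl⟩
    obtain ⟨j, hj, e⟩ := this
    have e1 := h.inj _ (hσI j hj) _ hi ((hσ j hj).trans e)
    have e2 := hconst j hj
    obtain rfl : j = i + (i₀ - σ i₀) := by omega
    exact ⟨hj, e⟩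
  refine ⟨i₀ - σ i₀, fun i => ⟨fun hi => (hI i hi).1, fun hi => ?_⟩, fun i hi => (hI i hi).2⟩
  have e1 := hconst _ hi
  have e2 := hσI _ hi
  rwa [e1, add_sub_cancel_right] at e2

theorem exists_ribbon (h : Chain I P M) : ∃ R : Ribbon S.Glue S.tiles,
    ∀ u R', trim R.r u = some R' ↔ ∃ j ∈ I, u = P j ∧ R' = S.rib (M j) := by
  have hL : 2 < S.len := (S.two_lt (M 0)).trans_le (S.n_le _)
  set L : ℤ := (S.len : ℤ) with hLdef
  have hL' : 2 < L := by omega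
  have hfull : ∀ j, j ∈ I → j + 1 ∈ I → (S.n (M j) : ℤ) = L := fun j h1 h2 => by
    rw [S.n_eq _ _ (h.link j h1 h2).1]
  set K : Set ℤ := {m | m / L ∈ I ∧ m % L < S.n (M (m / L))} with hK
  set p : ℤ → Pos := fun m => sc S.s (P (m / L)) + S.c (M (m / L)) (m % L).toNat with hp
  have hlt : ∀ m ∈ K, (m % L).toNat < S.n (M (m / L)) := by
    rintro m ⟨-, hm⟩
    have := Int.emod_nonneg m (show L ≠ 0 by omega)
    omega
  have hpinj : ∀ m ∈ K, ∀ m' ∈ K, p m = p m' → m = m' := by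
    intro m hm m' hm' e
    have e1 : m / L = m' / L := by
      by_contra hne
      exact h.disj _ hm.1 _ hm'.1 hne _ (hlt m hm) _ (hlt m' hm') e
    have hm2 := hlt m hm
    have hm2' := hlt m' hm'
    simp only [hp] at e
    rw [e1] at e hm2
    have e2 := S.inj _ _ _ hm2 hm2' (add_left_cancel e)
    have a := Int.emod_nonneg m (show L ≠ 0 by omega)
    have b := Int.emod_nonneg m' (show L ≠ 0 by omega)
    rw [← Int.mul_ediv_add_emod m L, ← Int.mul_ediv_add_emod m' L, e1,
      show m % L = m' % L by omega]
  have hfwd : ∀ m, m ∈ K → m + 1 ∈ K → S.Fwd (M (m / L)) (m % L).toNat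
      (M ((m + 1) / L)) ((m + 1) % L).toNat (p (m + 1) - p m) := by
    intro m hm hm'
    have a := Int.emod_nonneg m (show L ≠ 0 by omega)
    have b := Int.emod_lt_of_pos m (show 0 < L by omega)
    have e := Int.mul_ediv_add_emod m L
    have hlt' := hlt _ hm'
    simp only [hp]
    rcases (show m % L + 1 ≤ L by omega).eq_or_lt with hb | hb
    · obtain ⟨e1, e2⟩ := (Int.ediv_emod_unique (a := m + 1) (q := m / L + 1) (r := 0)
        (show 0 < L by omega)).2 ⟨by linarith, le_rfl, by omega⟩
      rw [e1, e2]
      have h2 : m / L + 1 ∈ I := e1 ▸ hm'.1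
      have hf := hfull _ hm.1 h2
      obtain ⟨ho, hin⟩ := h.link _ hm.1 h2
      have hv : sc S.s (P (m / L + 1)) + S.c (M (m / L + 1)) (Int.toNat 0) -
          (sc S.s (P (m / L)) + S.c (M (m / L)) (m % L).toNat) = P (m / L + 1) - P (m / L) := by
        have hl := S.last _ _ ho
        rw [Int.toNat_zero, S.head _ _ hin]
        rw [show S.n (M (m / L)) - 1 = (m % L).toNat by omega] at hl
        have := sc_add S.s (P (m / L)) (P (m / L + 1) - P (m / L))
        rw [add_sub_cancel] at this
        linear_combination this - hl
      rw [hv]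
      exact .inr ⟨by omega, ho, rfl, hin⟩
    · obtain ⟨e1, e2⟩ := (Int.ediv_emod_unique (a := m + 1) (q := m / L) (r := m % L + 1)
        (show 0 < L by omega)).2 ⟨by linarith, by omega, hb⟩
      rw [e1, e2] at hlt' ⊢
      rw [show (m % L + 1).toNat = (m % L).toNat + 1 by omega] at hlt' ⊢
      exact .inl ⟨hlt', rfl, rfl, by abel⟩
  set r : Pos → Option (Tile S.Glue Nvn) :=
    graphFn fun q a => ∃ m ∈ K, q = p m ∧ a = S.tile (M (m / L)) (m % L).toNat with hr
  have hrs : ∀ q a, r q = some a ↔ ∃ m ∈ K, q = p m ∧ a = S.tile (M (m / L)) (m % L).toNat := by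
    intro q a
    refine graphFn_eq_some ?_
    rintro q a b ⟨m, hm, rfl, rfl⟩ ⟨m', hm', e, rfl⟩
    rw [hpinj m hm m' hm' e]
  have hrp : ∀ m ∈ K, r (p m) = some (S.tile (M (m / L)) (m % L).toNat) := fun m hm =>
    (hrs _ _).2 ⟨m, hm, rfl, rfl⟩
  have hrib : IsRibbon S.tiles K p r := by
    refine ⟨⟨⟨?_, fun m h1 h2 => (hfwd m h1 h2).mem_Nvn⟩, ?_, ?_⟩, hpinj, ?_⟩
    · rintro a b c ⟨ha, -⟩ ⟨hc, hc'⟩ hab hbc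
      have h1 := Int.ediv_le_ediv (show 0 < L by omega) hab
      have h2 := Int.ediv_le_ediv (show 0 < L by omega) hbc
      have hb := h.interval _ _ _ ha hc h1 h2
      refine ⟨hb, ?_⟩
      rcases h2.eq_or_lt with e | hlt
      · have e1 := Int.mul_ediv_add_emod b L
        have e2 := Int.mul_ediv_add_emod c L
        rw [← e] at hc' e2
        omega
      · rw [hfull _ hb (h.interval _ _ _ hb hc (by omega) (by omega))]
        exact Int.emod_lt_of_pos b (by omega)
    · ext q
      simp only [tdom, Set.mem_ofPred_eq, Option.ne_none_iff_exists', hrs, Set.mem_image]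
      constructor
      · rintro ⟨_, m, hm, rfl, _⟩
        exact ⟨m, hm, rfl⟩
      · rintro ⟨m, hm, rfl⟩
        exact ⟨_, m, hm, rfl, rfl⟩
    · intro q a hq
      obtain ⟨m, hm, -, rfl⟩ := (hrs _ _).1 hq
      exact ⟨_, _, hlt m hm, rfl⟩
    · intro m h1 h2 t t' ht ht' hv hv'
      rw [hrp _ h1, Option.some.injEq] at ht
      rw [hrp _ h2, Option.some.injEq] at ht'
      subst ht ht'
      exact (hfwd m h1 h2).tile_eq (hlt _ h2) hv hv'
  refine ⟨⟨K, p, r, hrib⟩, fun u R' => ?_⟩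
  rw [trim_eq_some]
  constructor
  · rintro ⟨M', rfl, hM⟩
    obtain ⟨m, hm, e, ht⟩ := (hrs _ _).1 (hM 0 (by have := S.two_lt M'; omega))
    obtain ⟨rfl, h0⟩ := tile_inj (by have := S.two_lt M'; omega) (hlt m hm) ht
    refine ⟨m / L, hm.1, sc_injective S.hs ?_, rfl⟩
    simp only [hp, ← h0] at e
    exact add_right_cancel e
  · rintro ⟨j, hj, rfl, rfl⟩
    refine ⟨M j, rfl, fun k hk => (hrs _ _).2 ⟨L * j + k, ?_⟩⟩
    have hn := S.n_le (M j)
    obtain ⟨e1, e2⟩ := (Int.ediv_emod_unique (a := L * j + k) (q := j) (r := k)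
      (show 0 < L by omega)).2 ⟨by ring, by omega, by omega⟩
    simp only [hK, hp, Set.mem_ofPred_eq, e1, e2, Int.toNat_natCast]
    exact ⟨⟨hj, by omega⟩, by trivial, by trivial⟩

end Chain

theorem exists_chain {I : Set ℤ} {P : ℤ → Pos} {r : Pos → Option (Tile X Nvn)}
    (h : IsZipper T I P r) (hne : I.Nonempty) :
    ∃ M : ℤ → S.Mac, Chain I P M ∧ ∀ i ∈ I, r (P i) = some (S.lab (M i)) := by
  obtain ⟨⟨⟨hI, hadj⟩, hdom, hmem⟩, hinj, htil⟩ := h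
  have hex : ∀ i ∈ I, ∃ M, r (P i) = some (S.lab M) ∧
      S.inDir M = (if i - 1 ∈ I then some (P i - P (i - 1)) else none) ∧
      S.outDir M = (if i + 1 ∈ I then some (P (i + 1) - P i) else none) := by
    intro i hi
    have : P i ∈ tdom r := hdom ▸ ⟨i, hi, rfl⟩
    obtain ⟨t, ht⟩ := Option.ne_none_iff_exists'.1 this
    have key := S.exists_mac t (hmem _ _ ht)
      (if i - 1 ∈ I then some (P i - P (i - 1)) else none)
      (if i + 1 ∈ I then some (P (i + 1) - P i) else none)
    have h1 : ∀ d, (if i - 1 ∈ I then some (P i - P (i - 1)) else none) = some d → d ∈ Nvn := by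
      intro d hd
      split_ifs at hd with h1
      cases hd
      have := hadj (i - 1) h1 (by rwa [sub_add_cancel])
      rwa [sub_add_cancel] at this
    have h2 : ∀ d, (if i + 1 ∈ I then some (P (i + 1) - P i) else none) = some d → d ∈ Nvn := by
      intro d hd
      split_ifs at hd with h1
      cases hd
      exact hadj i hi h1
    obtain ⟨M, rfl, hM⟩ := key h1 h2 (by
      intro d hd
      split_ifs at hd with h1
      cases hd
      split_ifs with h2
      · intro e
        rw [Option.some.injEq, neg_sub, sub_left_inj] at e
        have := hinj _ h2 _ h1 e
        omega
      · simp)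
    exact ⟨M, ht, hM⟩
  obtain ⟨i₀, hi₀⟩ := hne
  have : Nonempty S.Mac := ⟨(hex i₀ hi₀).choose⟩
  choose! M hM hin hout using hex
  have hlink : ∀ j, j ∈ I → j + 1 ∈ I → S.outDir (M j) = some (P (j + 1) - P j) ∧
      S.inDir (M (j + 1)) = some (P (j + 1) - P j) := by
    intro j h1 h2
    rw [hin _ h2, hout j h1, if_pos h2]
    simp [h1]
  have hout' : ∀ j ∈ I, ∀ v, S.outDir (M j) = some v → j + 1 ∈ I ∧ P (j + 1) = P j + v := by
    intro j hj v hv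
    rw [hout j hj] at hv
    split_ifs at hv with h1
    rw [Option.some.injEq] at hv
    exact ⟨h1, by rw [← hv]; abel⟩
  refine ⟨M, ⟨hI, hinj, fun i hi j hj hij => ?_, hlink, fun j hj h => ?_⟩, hM⟩
  · refine S.disjoint _ _ _ _ (fun e => hij (hinj _ hi _ hj e)) (fun hw hw' => ?_) ?_
    · exact htil.2 _ _ (hM i hi) _ _ (by rw [add_sub_cancel]; exact hM j hj) hw hw'
    · rintro ⟨h1, h2⟩
      obtain ⟨hi', e1⟩ := hout' i hi _ h1
      obtain ⟨hj', e2⟩ := hout' j hj _ h2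
      have e3 := hinj _ hi' _ hj (by rw [e1]; abel)
      have e4 := hinj _ hj' _ hi (by rw [e2]; abel)
      omega
  · obtain ⟨v, hv⟩ := Option.ne_none_iff_exists'.1 h
    exact (hout' j hj v hv).1

/-- Every zipper is simulated by some ribbon. -/
theorem exists_ribbon_of_isZipper {I : Set ℤ} {P : ℤ → Pos} {r : Pos → Option (Tile X Nvn)}
    (h : IsZipper T I P r) : ∃ R : Ribbon S.Glue S.tiles, IsPolyRibbon S.s I P (trim R.r) ∧
      (∀ u t, r u = some t → ∀ R', trim R.r u = some R' → ∃ M, S.lab M = t ∧ R' = S.rib M) ∧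
      ∀ I' P', IsPolyRibbon S.s I' P' (trim R.r) → Shift I P I' P' := by
  rcases I.eq_empty_or_nonempty with rfl | hne
  · have hr : ∀ u, trim (S := S) (fun _ => none) u = none := by
      intro u
      by_contra h
      obtain ⟨M, hM⟩ := trim_ne_none.1 h
      have := hM 0 (by have := S.two_lt M; omega)
      simp at this
    refine ⟨⟨∅, P, fun _ => none, ⟨⟨⟨fun a b c ha => ha.elim, fun i hi => hi.elim⟩,
      by simp [tdom], by simp⟩, fun i hi => hi.elim, fun i hi => hi.elim⟩⟩,
      isPolyRibbon_empty hr, fun u t _ R' h => by simp [hr] at h, fun I' P' h => ?_⟩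
    have h1 := h.2.2.1
    simp only [tdom, hr, ne_eq, not_true_eq_false, Set.ofPred_false] at h1
    rw [eq_comm, Set.image_eq_empty] at h1
    subst h1
    exact ⟨0, fun i => Iff.rfl, fun i hi => hi.elim⟩
  obtain ⟨M, hM, hlab⟩ := S.exists_chain h hne
  obtain ⟨R, hR⟩ := hM.exists_ribbon
  refine ⟨R, hM.isPolyRibbon hR, fun u t hu R' hu' => ?_, fun I' P' => hM.shift_of_isPolyRibbon hR⟩
  obtain ⟨j, hj, rfl, rfl⟩ := (hR _ _).1 hu'
  rw [hlab j hj, Option.some.injEq] at hu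
  exact ⟨_, hu, rfl⟩

theorem Shift.symm {I I' : Set ℤ} {P P' : ℤ → Pos} (h : Shift I P I' P') : Shift I' P' I P := by
  obtain ⟨d, h1, h2⟩ := h
  have h3 : ∀ i, i ∈ I' ↔ i + -d ∈ I := fun i => by rw [h1, neg_add_cancel_right]
  refine ⟨-d, h3, fun i hi => ?_⟩
  rw [← h2 _ ((h3 i).1 hi), neg_add_cancel_right]

theorem Shift.trans {I I' I'' : Set ℤ} {P P' P'' : ℤ → Pos} (h : Shift I P I' P')
    (h' : Shift I' P' I'' P'') : Shift I P I'' P'' := by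
  obtain ⟨d, h1, h2⟩ := h
  obtain ⟨d', h1', h2'⟩ := h'
  refine ⟨d + d', fun i => by rw [h1, h1', add_assoc], fun i hi => ?_⟩
  rw [← add_assoc, h2' _ ((h1 i).1 hi), h2 i hi]

theorem Shift.refl (I : Set ℤ) (P : ℤ → Pos) : Shift I P I P := ⟨0, by simp, by simp⟩

/-- A chosen path of a poly-ribbon. -/
noncomputable def canon (ρ : Pos → Option (Ribbon S.Glue S.tiles)) : Set ℤ × (ℤ → Pos) :=
  Classical.epsilon fun IQ => IsPolyRibbon S.s IQ.1 IQ.2 ρ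

theorem isPolyRibbon_canon {I : Set ℤ} {P : ℤ → Pos} {ρ : Pos → Option (Ribbon S.Glue S.tiles)}
    (h : IsPolyRibbon S.s I P ρ) : IsPolyRibbon S.s (canon ρ).1 (canon ρ).2 ρ :=
  Classical.epsilon_spec (p := fun IQ : Set ℤ × (ℤ → Pos) => IsPolyRibbon S.s IQ.1 IQ.2 ρ)
    ⟨(I, P), h⟩

/-- The tile map read off from the macro-tiles occurring in a ribbon is a tiling. -/
theorem exists_isZipper_of_isPolyRibbon (R : Ribbon S.Glue S.tiles) {J : Set ℤ} {Q : ℤ → Pos}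
    (h : IsPolyRibbon S.s J Q (trim R.r)) : ∃ r, IsZipper T J Q r ∧
      ∀ u t, r u = some t → ∀ R', trim R.r u = some R' → ∃ M, S.lab M = t ∧ R' = S.rib M := by
  have hr : ∀ u t, graphFn (fun u t => ∃ M, t = S.lab M ∧ Complete R.r M u) u = some t ↔
      ∃ M, t = S.lab M ∧ Complete R.r M u := by
    intro u t
    refine graphFn_eq_some ?_
    rintro u t t' ⟨M, rfl, h⟩ ⟨M', rfl, h'⟩
    rw [h.unique h']
  refine ⟨graphFn (fun u t => ∃ M, t = S.lab M ∧ Complete R.r M u),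
    ⟨⟨h.1, ?_, ?_⟩, h.2.1, ?_, ?_⟩, ?_⟩
  · rw [← h.2.2.1]
    ext u
    simp only [tdom, Set.mem_ofPred_eq, trim_ne_none, graphFn_ne_none]
    exact ⟨fun ⟨_, M, _, h⟩ => ⟨M, h⟩, fun ⟨M, h⟩ => ⟨_, M, rfl, h⟩⟩
  · intro u t hu
    obtain ⟨M, rfl, -⟩ := (hr _ _).1 hu
    exact S.lab_mem M
  · intro u t hu
    obtain ⟨M, rfl, -⟩ := (hr _ _).1 hu
    exact S.lab_mem M
  · intro u t hu w t' hu' hw hw'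
    obtain ⟨M, rfl, hM⟩ := (hr _ _).1 hu
    obtain ⟨M', rfl, hM'⟩ := (hr _ _).1 hu'
    by_contra hne
    obtain ⟨i, hi, j, hj, e⟩ := S.collide M M' u w hw hw' hne
    have := (hM.overlap hM' hi hj e).1
    have hw0 : w = 0 := by simpa using this
    exact ne_neg_of_mem_Nvn hw (by simp [hw0])
  · intro u t hu R' hR'
    obtain ⟨M, rfl, hM⟩ := (hr _ _).1 hu
    obtain ⟨M', rfl, hM'⟩ := trim_eq_some.1 hR'
    rw [hM'.unique hM]
    exact ⟨M, rfl, rfl⟩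

variable (S) in
/-- The zipper-simulation given by a scheme of macro-tiles. -/
noncomputable def simulation : ZipperSimulation X S.Glue Nvn T S.tiles S.s where
  hs := S.hs
  phi t := {R | ∃ M, S.lab M = t ∧ R = S.rib M}
  phi_fin := by
    rintro t R ⟨M, -, rfl⟩
    exact rib_finite M
  phi_ref := by
    rintro t R ⟨M, -, rfl⟩
    obtain ⟨k, hk, e⟩ := S.zero_mem M
    rw [rib_r, ← e, ribMap_c hk]
    simp
  phi_spec := by
    rintro t t' hne R ⟨M, rfl, rfl⟩ R' ⟨M', rfl, rfl⟩ p q a b ha hb rfl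
    obtain ⟨k, hk, -, rfl⟩ := ribMap_eq_some.1 ha
    obtain ⟨k', hk', -, e⟩ := ribMap_eq_some.1 hb
    rw [(tile_inj hk hk' e).1] at hne
    exact hne rfl
  chi R := trim R.r
  chi_poly := exists_isPolyRibbon_trim
  chi_sub := by
    intro R u R' h
    obtain ⟨M, rfl, hM⟩ := trim_eq_some.1 h
    exact ⟨⟨_, S.lab_mem M, M, rfl, rfl⟩, complete_iff.1 hM⟩
  chi_max := by
    rintro R t ht R' ⟨M, rfl, rfl⟩ u h
    exact trim_ne_none.2 ⟨M, complete_iff.2 h⟩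
  psi I P r := {ρ | IsPolyRibbon S.s I P ρ ∧
    (∀ u t, r u = some t → ∀ R', ρ u = some R' → ∃ M, S.lab M = t ∧ R' = S.rib M) ∧
    Shift I P (canon ρ).1 (canon ρ).2}
  psi_nonempty := by
    intro I P r h
    obtain ⟨R, h1, h2, h3⟩ := exists_ribbon_of_isZipper h
    exact ⟨_, h1, h2, h3 _ _ (isPolyRibbon_canon h1)⟩
  psi_poly := fun I P r _ ρ h => h.1
  psi_comp := fun I P r _ ρ h => h.2.1
  psi_exists := by
    intro R
    obtain ⟨J, Q, h⟩ := exists_isPolyRibbon_trim R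
    have h := isPolyRibbon_canon h
    obtain ⟨r, hr, hlab⟩ := exists_isZipper_of_isPolyRibbon R h
    exact ⟨_, _, r, hr, h, hlab, Shift.refl _ _⟩
  psi_unique := by
    intro R I P r I' P' r' hz hz' h h'
    have hd : tdom r = tdom (trim R.r) := hz.1.2.1.trans h.1.2.2.1.symm
    have hd' : tdom r' = tdom (trim R.r) := hz'.1.2.1.trans h'.1.2.2.1.symm
    refine ⟨?_, h.2.2.trans h'.2.2.symm⟩
    funext u
    have e : r u ≠ none ↔ trim R.r u ≠ none := Set.ext_iff.1 hd u
    have e' : r' u ≠ none ↔ trim R.r u ≠ none := Set.ext_iff.1 hd' u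
    by_cases hu : trim R.r u = none
    · rw [not_not.1 fun hn => e.1 hn hu, not_not.1 fun hn => e'.1 hn hu]
    · obtain ⟨t, ht⟩ := Option.ne_none_iff_exists'.1 (e.2 hu)
      obtain ⟨t', ht'⟩ := Option.ne_none_iff_exists'.1 (e'.2 hu)
      obtain ⟨R', hR'⟩ := Option.ne_none_iff_exists'.1 hu
      obtain ⟨M, rfl, rfl⟩ := h.2.1 u t ht R' hR'
      obtain ⟨M', rfl, e⟩ := h'.2.1 u t' ht' _ hR'
      rw [ht, ht', rib_inj e]

variable (S) in
theorem tiles_finite : S.tiles.Finite := by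
  have := S.mac_finite
  exact Set.toFinite _

theorem exists_zipperSimulation (S : Scheme T) :
    ∃ (Xμ : Type) (_ : Fintype Xμ) (Tμ : Set (Tile Xμ Nvn)) (_ : Tμ.Finite)
      (s : ℤ) (sim : ZipperSimulation X Xμ Nvn T Tμ s),
      ∀ I P r, IsZipper T I P r → ∃ R : Ribbon Xμ Tμ, sim.chi R ∈ sim.psi I P r := by
  have := S.mac_finite
  refine ⟨S.Glue, Fintype.ofFinite _, S.tiles, S.tiles_finite, S.s, S.simulation,
    fun I P r h => ?_⟩
  obtain ⟨R, h1, h2, h3⟩ := exists_ribbon_of_isZipper h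
  exact ⟨R, h1, h2, h3 _ _ (isPolyRibbon_canon h1)⟩
end Scheme

/-- The four directions, counterclockwise. -/
def vec : Fin 4 → Pos := ![(1, 0), (0, 1), (-1, 0), (0, -1)]

/-- The point with coordinates `(a, b)` in the frame whose first axis has direction `e`. -/
def pt : Fin 4 → ℤ → ℤ → Pos
  | 0, a, b => (a, b)
  | 1, a, b => (-b, a)
  | 2, a, b => (-a, -b)
  | 3, a, b => (b, -a)

/-- A macro-tile is made of single cells and of arms, travelled outward or inward. -/
inductive Item
  | core (p : Pos)
  | arm (out : Bool) (e : Fin 4) (y : ℤ)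

namespace Item

/-- The part of the macro-tile covered by an item. -/
def key : Item → Pos ⊕ (Fin 4 × ℤ)
  | core p => .inl p
  | arm _ e y => .inr (e, y)

/-- Sufficient condition for an item to be followed by another one. -/
def link : Item → Item → Bool
  | core p, core q => q - p = (0, 1) ∨ q - p = (1, 0) ∨ q - p = (0, -1) ∨ q - p = (-1, 0)
  | core p, arm true e y => p = pt e 2 y
  | arm true e y, arm false e' y' =>
    e = e' ∧ (0 < y ↔ 0 < y') ∧ (y < 0 ↔ y' < 0) ∧ (y' = y + 1 ∨ y' = y - 1)
  | arm false e y, core p => p = pt e 2 y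
  | _, _ => false

/-- The excursion along two neighboring arms, between two core cells on a side of the core. -/
def detour (p q : Pos) : List Item :=
  [0, 1, 2, 3].flatMap fun e : Fin 4 => [1, 2, -1, -2].flatMap fun y : ℤ =>
    [1, 2, -1, -2].flatMap fun y' : ℤ =>
      if p = pt e 2 y ∧ q = pt e 2 y' ∧ y * y' = 2 then [arm true e y, arm false e y'] else []

/-- The items along a path in the core. -/
def route : List Pos → List Item
  | p :: q :: l => core p :: (detour p q ++ route (q :: l))
  | [p] => [core p]
  | [] => []

end Item

open Item

/-- The path through the core, entered from the West and left to the East. -/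
def straight : List Pos :=
  [(-2, 0), (-2, 1), (-2, 2), (-1, 2), (0, 2), (1, 2), (2, 2), (2, 1), (1, 1), (0, 1), (-1, 1),
    (-1, 0), (0, 0), (1, 0), (1, -1), (0, -1), (-1, -1), (-2, -1), (-2, -2), (-1, -2), (0, -2),
    (1, -2), (2, -2), (2, -1), (2, 0)]

/-- The path through the core, entered from the West and left to the South. -/
def rightTurn : List Pos :=
  [(-2, 0), (-2, 1), (-2, 2), (-1, 2), (0, 2), (1, 2), (2, 2), (2, 1), (2, 0), (2, -1), (2, -2),
    (1, -2), (1, -1), (1, 0), (1, 1), (0, 1), (-1, 1), (-1, 0), (0, 0), (0, -1), (-1, -1),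
    (-2, -1), (-2, -2), (-1, -2), (0, -2)]

/-- The path through the core, entered in direction `d` with a turn `τ` (straight, left, right). -/
def corePath (d : Fin 4) (τ : Fin 3) : List Pos :=
  (![straight, rightTurn.map fun p => (p.1, -p.2), rightTurn] τ).map fun p => pt d p.1 p.2

/-- The direction after the turn `τ`. -/
def exitDir (d : Fin 4) (τ : Fin 3) : Fin 4 := d + ![0, 1, 3] τ

/-- The items of a macro-tile, with a final arm if `b`. -/
def items (d : Fin 4) (τ : Fin 3) (b : Bool) : List Item :=
  route (corePath d τ) ++ if b then [arm true (exitDir d τ) 0] else []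

/-- The cells of the core and the arms of positive or negative ordinate. -/
def baseKeys : List (Pos ⊕ (Fin 4 × ℤ)) :=
  (([-2, -1, 0, 1, 2] : List ℤ) ×ˢ ([-2, -1, 0, 1, 2] : List ℤ)).map .inl ++
    (([0, 1, 2, 3] : List (Fin 4)) ×ˢ ([1, 2, -1, -2] : List ℤ)).map .inr

theorem route_perm : ∀ (d : Fin 4) (τ : Fin 3),
    ((route (corePath d τ)).map key).Perm baseKeys := by
  decide +kernel

theorem items_isChain : ∀ (d : Fin 4) (τ : Fin 3) (b : Bool),
    (items d τ b).IsChain fun i j => link i j = true := by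
  decide +kernel

/-- The cells of an item, when `L e y` is the length of the arm of side `e` and ordinate `y`. -/
def Item.cells (L : Fin 4 → ℤ → ℕ) : Item → List Pos
  | core p => [p]
  | arm true e y => (List.range (L e y)).map fun j : ℕ => pt e (3 + j) y
  | arm false e y => ((List.range (L e y)).map fun j : ℕ => pt e (3 + j) y).reverse

theorem mem_cells_arm {L : Fin 4 → ℤ → ℕ} {o : Bool} {e : Fin 4} {y : ℤ} {p : Pos} :
    p ∈ (arm o e y).cells L ↔ ∃ j < L e y, p = pt e (3 + j) y := by
  cases o <;> simp [Item.cells, eq_comm]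

theorem pt_arm_inj {e e' : Fin 4} {y y' : ℤ} {j j' : ℕ} (hy : -2 ≤ y ∧ y ≤ 2)
    (hy' : -2 ≤ y' ∧ y' ≤ 2) (h : pt e (3 + j) y = pt e' (3 + j') y') :
    e = e' ∧ y = y' ∧ j = j' := by
  fin_cases e <;> fin_cases e' <;> simp [pt] at h ⊢ <;> omega

theorem pt_arm_not_core {e : Fin 4} {y : ℤ} {j : ℕ} {p : Pos} (h : p = pt e (3 + j) y) :
    ¬ ((-2 ≤ p.1 ∧ p.1 ≤ 2) ∧ -2 ≤ p.2 ∧ p.2 ≤ 2) := by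
  subst h
  fin_cases e <;> simp [pt] <;> omega

theorem pt_succ_sub_mem (e : Fin 4) (a y : ℤ) : pt e (a + 1) y - pt e a y ∈ Nvn := by
  rw [mem_Nvn_iff]
  fin_cases e <;> simp [pt]

theorem pt_sub_mem (e : Fin 4) (a : ℤ) {y y' : ℤ} (h : y' = y + 1 ∨ y' = y - 1) :
    pt e a y' - pt e a y ∈ Nvn := by
  rw [mem_Nvn_iff]
  rcases h with rfl | rfl <;> fin_cases e <;> simp [pt]

theorem sub_mem_Nvn_comm {p q : Pos} (h : p - q ∈ Nvn) : q - p ∈ Nvn := by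
  have := neg_mem_Nvn h
  rwa [neg_sub] at this

theorem cells_isChain (L : Fin 4 → ℤ → ℕ) (i : Item) :
    (i.cells L).IsChain fun p q => q - p ∈ Nvn := by
  have key : ∀ e y, ((List.range (L e y)).map fun j : ℕ => pt e (3 + j) y).IsChain
      fun p q => q - p ∈ Nvn := by
    intro e y
    rw [List.isChain_map, List.isChain_range]
    intro m _
    rw [Nat.cast_succ, ← add_assoc]
    exact pt_succ_sub_mem _ _ _
  rcases i with p | ⟨_ | _, e, y⟩
  · exact List.isChain_singleton _
  · simp only [Item.cells, List.isChain_reverse]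
    exact (key e y).imp fun _ _ h => sub_mem_Nvn_comm h
  · exact key e y

theorem cells_nodup (L : Fin 4 → ℤ → ℕ) (i : Item) : (i.cells L).Nodup := by
  have key : ∀ e y, ((List.range (L e y)).map fun j : ℕ => pt e (3 + j) y).Nodup := by
    intro e y
    refine List.nodup_range.map fun j j' h => ?_
    fin_cases e <;> simp [pt] at h <;> omega
  rcases i with p | ⟨_ | _, e, y⟩
  · exact List.nodup_singleton _
  · exact List.nodup_reverse.2 (key e y)
  · exact key e y

theorem sub_mem_of_link {L : Fin 4 → ℤ → ℕ}
    (hL : ∀ e y y', (0 < y ↔ 0 < y') → (y < 0 ↔ y' < 0) → L e y = L e y') {i j : Item}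
    (h : link i j = true) {p q : Pos} (hp : p ∈ (i.cells L).getLast?) (hq : q ∈ (j.cells L).head?) :
    q - p ∈ Nvn := by
  rcases i with p' | ⟨_ | _, e, y⟩ <;> rcases j with q' | ⟨_ | _, e', y'⟩ <;>
    simp only [link, decide_eq_true_eq, Bool.false_eq_true] at h
  · simp only [Item.cells, List.getLast?_singleton, List.head?_cons, Option.mem_some] at hp hq
    subst hp hq
    rw [mem_Nvn_iff]
    exact h
  · simp only [Item.cells, List.getLast?_singleton, List.head?_map, List.head?_range,
      Option.mem_def, Option.some.injEq, Option.map_eq_some_iff] at hp hq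
    obtain ⟨k, hk, rfl⟩ := hq
    split_ifs at hk
    cases hk
    subst hp h
    exact pt_succ_sub_mem e' 2 y'
  · simp only [Item.cells, List.getLast?_reverse, List.head?_map, List.head?_range,
      List.head?_cons, Option.mem_def, Option.some.injEq, Option.map_eq_some_iff] at hp hq
    obtain ⟨k, hk, rfl⟩ := hp
    split_ifs at hk
    cases hk
    subst hq h
    exact sub_mem_Nvn_comm (pt_succ_sub_mem e 2 y)
  · obtain ⟨rfl, h1, h2, h3⟩ := h
    simp only [Item.cells, List.head?_reverse, List.getLast?_map, List.getLast?_range,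
      Option.mem_def, Option.map_eq_some_iff, hL e y y' h1 h2] at hp hq
    obtain ⟨k, hk, rfl⟩ := hp
    obtain ⟨k', hk', rfl⟩ := hq
    rw [hk, Option.some.injEq] at hk'
    subst hk'
    exact pt_sub_mem e _ h3

/-- The length of the arms of a macro-tile, where `x` is the direction it is left in and `ℓ e`
encodes the glue of its side `e`. -/
def armLen (w : ℕ) (ℓ : Fin 4 → ℕ) (x : Option (Fin 4)) (e : Fin 4) (y : ℤ) : ℕ :=
  if 0 < y then ℓ e else if y < 0 then w - ℓ e else if x = some e then w else 0

/-- The direction a macro-tile is left in. -/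
def exitOpt (d : Fin 4) (τ : Fin 3) (b : Bool) : Option (Fin 4) :=
  if b then some (exitDir d τ) else none

/-- The cells of a macro-tile. -/
def macroCells (w : ℕ) (ℓ : Fin 4 → ℕ) (d : Fin 4) (τ : Fin 3) (b : Bool) : List Pos :=
  (items d τ b).flatMap (Item.cells (armLen w ℓ (exitOpt d τ b)))

theorem items_perm (d : Fin 4) (τ : Fin 3) (b : Bool) : ((items d τ b).map key).Perm
    (baseKeys ++ if b then [.inr (exitDir d τ, 0)] else []) := by
  rw [items, List.map_append]
  refine (route_perm d τ).append ?_
  cases b <;> simp [key]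

theorem mem_baseKeys {k : Pos ⊕ (Fin 4 × ℤ)} : k ∈ baseKeys ↔
    (∃ p : Pos, ((-2 ≤ p.1 ∧ p.1 ≤ 2) ∧ -2 ≤ p.2 ∧ p.2 ≤ 2) ∧ k = .inl p) ∨
    ∃ e y, (y = 1 ∨ y = 2 ∨ y = -1 ∨ y = -2) ∧ k = .inr (e, y) := by
  have h5 : ∀ a : ℤ, a ∈ ([-2, -1, 0, 1, 2] : List ℤ) ↔ -2 ≤ a ∧ a ≤ 2 := by
    intro a
    simp only [List.mem_cons, List.not_mem_nil, or_false]
    omega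
  have h4 : ∀ e : Fin 4, e ∈ ([0, 1, 2, 3] : List (Fin 4)) := by decide
  rw [baseKeys, List.mem_append, List.mem_map, List.mem_map]
  refine or_congr (exists_congr fun p => ?_) ⟨?_, ?_⟩
  · rw [List.mem_product, h5, h5, eq_comm]
  · rintro ⟨⟨e, y⟩, h, rfl⟩
    exact ⟨e, y, by simpa using (List.mem_product.1 h).2, rfl⟩
  · rintro ⟨e, y, h, rfl⟩
    exact ⟨(e, y), List.mem_product.2 ⟨h4 e, by simpa using h⟩, rfl⟩

theorem mem_items_key {d : Fin 4} {τ : Fin 3} {b : Bool} {k : Pos ⊕ (Fin 4 × ℤ)} :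
    (∃ i ∈ items d τ b, key i = k) ↔
    (∃ p : Pos, ((-2 ≤ p.1 ∧ p.1 ≤ 2) ∧ -2 ≤ p.2 ∧ p.2 ≤ 2) ∧ k = .inl p) ∨
    ∃ e y, (y = 1 ∨ y = 2 ∨ y = -1 ∨ y = -2 ∨ (y = 0 ∧ exitOpt d τ b = some e)) ∧
      k = .inr (e, y) := by
  rw [← List.mem_map, (items_perm d τ b).mem_iff, List.mem_append, mem_baseKeys]
  cases b
  · simp [exitOpt]
  · simp only [exitOpt, if_true, List.mem_singleton, Option.some.injEq]
    constructor
    · rintro ((h | ⟨e, y, h, rfl⟩) | rfl)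
      · exact .inl h
      · exact .inr ⟨e, y, by tauto, rfl⟩
      · exact .inr ⟨_, 0, by tauto, rfl⟩
    · rintro (h | ⟨e, y, h | h | h | h | ⟨rfl, rfl⟩, rfl⟩)
      · exact .inl (.inl h)
      all_goals first | exact .inr rfl | exact .inl (.inr ⟨_, _, by tauto, rfl⟩)

theorem mem_items {d : Fin 4} {τ : Fin 3} {b : Bool} {i : Item} (h : i ∈ items d τ b) :
    (∃ p : Pos, ((-2 ≤ p.1 ∧ p.1 ≤ 2) ∧ -2 ≤ p.2 ∧ p.2 ≤ 2) ∧ i = core p) ∨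
    ∃ o e y, (y = 1 ∨ y = 2 ∨ y = -1 ∨ y = -2 ∨ (y = 0 ∧ exitOpt d τ b = some e)) ∧
      i = arm o e y := by
  rcases i with p | ⟨o, e, y⟩
  · rcases mem_items_key.1 ⟨_, h, rfl⟩ with ⟨q, hq, e⟩ | ⟨e, y, _, h⟩
    · cases e
      exact .inl ⟨p, hq, rfl⟩
    · cases h
  · rcases mem_items_key.1 ⟨_, h, rfl⟩ with ⟨q, hq, e⟩ | ⟨e, y, hy, h⟩
    · cases e
    · cases h
      exact .inr ⟨_, _, _, hy, rfl⟩

section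

variable {w : ℕ} {ℓ : Fin 4 → ℕ} {d : Fin 4} {τ : Fin 3} {b : Bool}

theorem armLen_le {x : Option (Fin 4)} (hℓ : ∀ e, 1 ≤ ℓ e ∧ ℓ e < w) (e : Fin 4) (y : ℤ) :
    armLen w ℓ x e y ≤ w := by
  have := hℓ e
  unfold armLen
  split_ifs <;> omega

theorem armLen_pos (hℓ : ∀ e, 1 ≤ ℓ e ∧ ℓ e < w) {e : Fin 4} {y : ℤ}
    (hy : y = 1 ∨ y = 2 ∨ y = -1 ∨ y = -2 ∨ (y = 0 ∧ exitOpt d τ b = some e)) :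
    0 < armLen w ℓ (exitOpt d τ b) e y := by
  have := hℓ e
  rcases hy with rfl | rfl | rfl | rfl | ⟨rfl, h⟩ <;> simp [armLen, *] <;> omega

/-- A superset of the cells of a macro-tile with arms of length `L`. -/
def Near (L : Fin 4 → ℤ → ℕ) (p : Pos) : Prop :=
  ((-2 ≤ p.1 ∧ p.1 ≤ 2) ∧ -2 ≤ p.2 ∧ p.2 ≤ 2) ∨
  ∃ e y, ∃ j < L e y, (-2 ≤ y ∧ y ≤ 2) ∧ p = pt e (3 + j) y

theorem near_of_mem {p : Pos} (h : p ∈ macroCells w ℓ d τ b) :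
    Near (armLen w ℓ (exitOpt d τ b)) p := by
  obtain ⟨i, hi, hp⟩ := List.mem_flatMap.1 h
  rcases mem_items hi with ⟨q, hq, rfl⟩ | ⟨o, e, y, hy, rfl⟩
  · obtain rfl : p = q := by simpa [Item.cells] using hp
    exact .inl hq
  · obtain ⟨j, hj, rfl⟩ := mem_cells_arm.1 hp
    exact .inr ⟨e, y, j, hj, by omega, rfl⟩

theorem core_mem_macroCells {p : Pos} (hp : (-2 ≤ p.1 ∧ p.1 ≤ 2) ∧ -2 ≤ p.2 ∧ p.2 ≤ 2) :
    p ∈ macroCells w ℓ d τ b := by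
  obtain ⟨i, hi, hk⟩ := (mem_items_key (d := d) (τ := τ) (b := b)).2 (.inl ⟨p, hp, rfl⟩)
  rcases i with q | ⟨o, e, y⟩
  · cases hk
    exact List.mem_flatMap.2 ⟨_, hi, by simp [Item.cells]⟩
  · cases hk

theorem arm_mem_macroCells {e : Fin 4} {y : ℤ} (hy : y = 1 ∨ y = -1) {j : ℕ}
    (hj : j < armLen w ℓ (exitOpt d τ b) e y) : pt e (3 + j) y ∈ macroCells w ℓ d τ b := by
  obtain ⟨i, hi, hk⟩ := (mem_items_key (d := d) (τ := τ) (b := b) (k := .inr (e, y))).2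
    (.inr ⟨e, y, by tauto, rfl⟩)
  rcases i with q | ⟨o, e, y⟩
  · cases hk
  · cases hk
    exact List.mem_flatMap.2 ⟨_, hi, mem_cells_arm.2 ⟨j, hj, rfl⟩⟩

theorem macroCells_nodup : (macroCells w ℓ d τ b).Nodup := by
  refine List.nodup_flatMap.2 ⟨fun i _ => cells_nodup _ i, ?_⟩
  have hnd : ((items d τ b).map key).Nodup := by
    rw [(items_perm d τ b).nodup_iff]
    revert d τ b
    decide +kernel
  refine (List.pairwise_map.1 hnd).imp_of_mem fun {i j} hi hj hne => ?_
  intro p hp hp'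
  rcases mem_items hi with ⟨q, hq, rfl⟩ | ⟨o, e, y, hy, rfl⟩ <;>
    rcases mem_items hj with ⟨q', hq', rfl⟩ | ⟨o', e', y', hy', rfl⟩
  · simp only [Item.cells, List.mem_singleton] at hp hp'
    exact hne (by rw [← hp, ← hp'])
  · simp only [Item.cells, List.mem_singleton] at hp
    obtain ⟨j, hj, e⟩ := mem_cells_arm.1 hp'
    exact pt_arm_not_core e (hp ▸ hq)
  · simp only [Item.cells, List.mem_singleton] at hp'
    obtain ⟨j, hj, e⟩ := mem_cells_arm.1 hp
    exact pt_arm_not_core e (hp' ▸ hq')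
  · obtain ⟨j, hj, rfl⟩ := mem_cells_arm.1 hp
    obtain ⟨j', hj', e⟩ := mem_cells_arm.1 hp'
    obtain ⟨rfl, rfl, -⟩ := pt_arm_inj (by omega) (by omega) e
    exact hne rfl

theorem macroCells_isChain (hℓ : ∀ e, 1 ≤ ℓ e ∧ ℓ e < w) :
    (macroCells w ℓ d τ b).IsChain fun p q => q - p ∈ Nvn := by
  rw [macroCells, List.flatMap_def, List.isChain_flatten]
  · refine ⟨fun l hl => ?_, ?_⟩
    · obtain ⟨i, -, rfl⟩ := List.mem_map.1 hl
      exact cells_isChain _ i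
    · rw [List.isChain_map]
      refine (items_isChain d τ b).imp fun i j h p hp q hq => sub_mem_of_link ?_ h hp hq
      intro e y y' h1 h2
      simp only [armLen, h1, h2]
  · intro h
    obtain ⟨i, hi, e⟩ := List.mem_map.1 h
    rcases mem_items hi with ⟨q, hq, rfl⟩ | ⟨o, e', y, hy, rfl⟩
    · simp [Item.cells] at e
    · have := armLen_pos hℓ hy
      have h0 : pt e' (3 + (0 : ℕ)) y ∈ (arm o e' y).cells (armLen w ℓ (exitOpt d τ b)) :=
        mem_cells_arm.2 ⟨0, this, rfl⟩
      rw [e] at h0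
      exact List.not_mem_nil h0

/-- The number of cells of an item, as a function of its key. -/
def keyLength (L : Fin 4 → ℤ → ℕ) : Pos ⊕ (Fin 4 × ℤ) → ℕ :=
  Sum.elim (fun _ => 1) fun x => L x.1 x.2

theorem length_macroCells (hℓ : ∀ e, 1 ≤ ℓ e ∧ ℓ e < w) :
    (macroCells w ℓ d τ b).length = 25 + 8 * w + if b then w else 0 := by
  set L := armLen w ℓ (exitOpt d τ b) with hL
  have e : ∀ i : Item, (i.cells L).length = keyLength L (key i) := by
    rintro (p | ⟨_ | _, e, y⟩) <;> simp [Item.cells, keyLength, key]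
  have e2 : ∀ l : List Item, (l.flatMap (Item.cells L)).length =
      ((l.map key).map (keyLength L)).sum := by
    intro l
    rw [List.length_flatMap, List.map_map]
    simp only [e, Function.comp_def]
  have e3 : (baseKeys.map (keyLength L)).sum = 25 + 8 * w := by
    have h0 := hℓ 0
    have h1 := hℓ 1
    have h2 := hℓ 2
    have h3 := hℓ 3
    rw [baseKeys, List.map_append, List.map_map, List.map_map, List.sum_append]
    have hc : keyLength L ∘ Sum.inl = fun _ => 1 := rfl
    rw [hc, List.map_const', List.sum_replicate, List.length_product]
    simp only [SProd.sprod, List.product, List.flatMap_cons, List.flatMap_nil, List.map_cons, List.map_nil,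
      List.cons_append, List.nil_append, List.sum_cons, List.sum_nil, Function.comp_apply,
      keyLength, Sum.elim_inr, List.length_cons, List.length_nil, hL, armLen]
    norm_num
    omega
  rw [macroCells, ← hL, e2, ((items_perm d τ b).map _).sum_eq, List.map_append, List.sum_append, e3]
  cases b <;> simp [keyLength, hL, armLen, exitOpt]

theorem macroCells_head : (macroCells w ℓ d τ b).getD 0 (0, 0) = pt d (-2) 0 := by
  obtain ⟨l, hl⟩ : ∃ l, route (corePath d τ) = core (pt d (-2) 0) :: l := by
    fin_cases d <;> fin_cases τ <;> exact ⟨_, rfl⟩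
  simp [macroCells, items, hl, Item.cells]

theorem macroCells_last (hℓ : ∀ e, 1 ≤ ℓ e ∧ ℓ e < w) :
    (macroCells w ℓ d τ true).getD (25 + 8 * w + w - 1) (0, 0) = pt (exitDir d τ) (w + 2) 0 := by
  have hw := hℓ 0
  have hlen := length_macroCells (d := d) (τ := τ) (b := true) hℓ
  have hlast : (arm true (exitDir d τ) 0).cells (armLen w ℓ (exitOpt d τ true)) =
      (List.range w).map fun j : ℕ => pt (exitDir d τ) (3 + j) 0 := by
    simp [Item.cells, armLen, exitOpt]
  rw [macroCells, items, if_pos rfl, List.flatMap_append, List.flatMap_singleton, hlast] at hlen ⊢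
  rw [List.length_append, List.length_map, List.length_range, if_pos rfl] at hlen
  rw [List.getD_append_right _ _ _ _ (by omega), List.getD_eq_getElem _ _
    (by rw [List.length_map, List.length_range]; omega)]
  simp only [List.getElem_map, List.getElem_range]
  congr 1
  omega

end

theorem Near.cases {L : Fin 4 → ℤ → ℕ} {p : Pos} (h : Near L p) :
    ((-2 ≤ p.1 ∧ p.1 ≤ 2) ∧ -2 ≤ p.2 ∧ p.2 ≤ 2) ∨
    (3 ≤ p.1 ∧ (-2 ≤ p.2 ∧ p.2 ≤ 2) ∧ p.1 - 3 < L 0 p.2) ∨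
    (3 ≤ p.2 ∧ (-2 ≤ p.1 ∧ p.1 ≤ 2) ∧ p.2 - 3 < L 1 (-p.1)) ∨
    (p.1 ≤ -3 ∧ (-2 ≤ p.2 ∧ p.2 ≤ 2) ∧ -p.1 - 3 < L 2 (-p.2)) ∨
    (p.2 ≤ -3 ∧ (-2 ≤ p.1 ∧ p.1 ≤ 2) ∧ -p.2 - 3 < L 3 p.1) := by
  rcases h with h | ⟨e, y, j, hj, hy, rfl⟩
  · exact .inl h
  · fin_cases e <;> simp [pt] at hj ⊢ <;> omega

theorem Near.le {L : Fin 4 → ℤ → ℕ} {w : ℕ} (hL : ∀ e y, L e y ≤ w) {p : Pos} (h : Near L p) :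
    (-(w + 2 : ℤ) ≤ p.1 ∧ p.1 ≤ w + 2) ∧ -(w + 2 : ℤ) ≤ p.2 ∧ p.2 ≤ w + 2 := by
  have h0 := hL 0 p.2
  have h1 := hL 1 (-p.1)
  have h2 := hL 2 (-p.2)
  have h3 := hL 3 p.1
  rcases h.cases with h | h | h | h | h <;> omega

/-- Macro-tiles at distinct positions are disjoint when no two opposite arms overlap. -/
theorem Near.ne {L L' : Fin 4 → ℤ → ℕ} {w : ℕ} (hL : ∀ e y, L e y ≤ w) (hL' : ∀ e y, L' e y ≤ w)
    {v : Pos} (hv : v ≠ 0) (h : ∀ e y, v = vec e → L e y + L' (e + 2) (-y) ≤ w) {p q : Pos}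
    (hp : Near L p) (hq : Near L' q) : p ≠ sc (w + 5) v + q := by
  rintro rfl
  obtain ⟨a, b⟩ := v
  obtain ⟨x, y⟩ := q
  have bound : ∀ a p q : ℤ, p = (w + 5) * a + q → (-(w + 2 : ℤ) ≤ p ∧ p ≤ w + 2) →
      (-(w + 2 : ℤ) ≤ q ∧ q ≤ w + 2) → -1 ≤ a ∧ a ≤ 1 := by
    intro a p q e hp hq
    constructor <;> by_contra ha <;> nlinarith
  obtain ⟨ha1, ha2⟩ := bound a _ x rfl (hp.le hL).1 (hq.le hL').1
  obtain ⟨hb1, hb2⟩ := bound b _ y rfl (hp.le hL).2 (hq.le hL').2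
  have bp := hp.le hL
  have bq := hq.le hL'
  replace hp := hp.cases
  replace hq := hq.cases
  interval_cases a <;> interval_cases b <;>
    simp only [sc, Prod.mk_add_mk, mul_zero, mul_one, zero_add, mul_neg] at hp bp hq bq
  · omega
  · have := h 2 (-y) rfl
    simp at this
    omega
  · omega
  · have := h 3 x rfl
    simp at this
    omega
  · exact hv rfl
  · have := h 1 (-x) rfl
    simp at this
    omega
  · omega
  · have := h 0 y rfl
    simp at this
    omega
  · omega

theorem exists_vec {v : Pos} (hv : v ∈ Nvn) : ∃ e, vec e = v := by
  rw [mem_Nvn_iff] at hv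
  rcases hv with rfl | rfl | rfl | rfl
  exacts [⟨1, rfl⟩, ⟨0, rfl⟩, ⟨3, rfl⟩, ⟨2, rfl⟩]

theorem vec_mem (e : Fin 4) : vec e ∈ Nvn := by
  rw [mem_Nvn_iff]
  revert e
  decide

theorem vec_injective : Function.Injective vec := by
  decide

theorem vec_add_two (e : Fin 4) : vec (e + 2) = -vec e := by
  revert e
  decide

theorem exists_exitDir : ∀ d e : Fin 4, vec e ≠ -vec d → ∃ τ, exitDir d τ = e := by
  decide

theorem exitDir_ne : ∀ (d : Fin 4) (τ : Fin 3), exitDir d τ ≠ d + 2 := by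
  decide

theorem pt_overlap (w : ℕ) (e : Fin 4) {a a' : ℤ} (h : a + a' = w + 5) (y : ℤ) :
    pt e a y = sc (w + 5) (vec e) + pt (e + 2) a' (-y) := by
  rw [← h]
  fin_cases e <;> ext <;> simp [pt, vec, sc]

section

variable {X : Type} [Fintype X]

/-- The encoding of the glue of a tile on each side. -/
noncomputable def glueLen (t : Tile X Nvn) (e : Fin 4) : ℕ :=
  Fintype.equivFin X (t ⟨vec e, vec_mem e⟩) + 1

theorem glueLen_mem (t : Tile X Nvn) (e : Fin 4) :
    1 ≤ glueLen t e ∧ glueLen t e < Fintype.card X + 1 := by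
  have := (Fintype.equivFin X (t ⟨vec e, vec_mem e⟩)).2
  unfold glueLen
  omega

theorem glueLen_eq_iff {t t' : Tile X Nvn} {e e' : Fin 4} : glueLen t e = glueLen t' e' ↔
    t ⟨vec e, vec_mem e⟩ = t' ⟨vec e', vec_mem e'⟩ := by
  simp [glueLen, Fin.val_inj]

end

/-- A macro-tile: the tile it simulates, the direction it is entered in, the turn it makes, and
whether it is linked to a macro-tile before it and after it. -/
structure MacroTile {X : Type} (T : Set (Tile X Nvn)) where
  tile : Tile X Nvn
  tile_mem : tile ∈ T
  dir : Fin 4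
  turn : Fin 3
  hasIn : Bool
  hasOut : Bool

namespace MacroTile

variable {X : Type} {T : Set (Tile X Nvn)}

theorem finite (hT : T.Finite) : Finite (MacroTile T) := by
  have := hT.to_subtype
  refine Finite.of_injective
    (fun M : MacroTile T => ((⟨M.tile, M.tile_mem⟩ : T), M.dir, M.turn, M.hasIn, M.hasOut)) fun M M' h => ?_
  cases M
  cases M'
  simpa using h

variable (M : MacroTile T)

/-- The direction in which a macro-tile is entered. -/
def inDir : Option Pos := if M.hasIn then some (vec M.dir) else none

/-- The direction in which a macro-tile is left. -/
def outDir : Option Pos := if M.hasOut then some (vec (exitDir M.dir M.turn)) else none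

variable {M} {M' : MacroTile T}

theorem inDir_eq_some {v : Pos} : M.inDir = some v ↔ M.hasIn ∧ vec M.dir = v := by
  unfold inDir
  split_ifs with h <;> simp [h]

theorem outDir_eq_some {v : Pos} :
    M.outDir = some v ↔ M.hasOut ∧ vec (exitDir M.dir M.turn) = v := by
  unfold outDir
  split_ifs with h <;> simp [h]

theorem exitOpt_eq_some {e : Fin 4} :
    exitOpt M.dir M.turn M.hasOut = some e ↔ M.outDir = some (vec e) := by
  rw [outDir_eq_some, vec_injective.eq_iff]
  unfold exitOpt
  split_ifs with h <;> simp [h]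

variable [Fintype X]

variable (M) in
/-- The cells of a macro-tile, in order. -/
noncomputable def cells : List Pos :=
  macroCells (Fintype.card X + 1) (glueLen M.tile) M.dir M.turn M.hasOut

variable (M) in
/-- The lengths of the arms of a macro-tile. -/
noncomputable def arms : Fin 4 → ℤ → ℕ :=
  armLen (Fintype.card X + 1) (glueLen M.tile) (exitOpt M.dir M.turn M.hasOut)

theorem arms_le (e : Fin 4) (y : ℤ) : M.arms e y ≤ Fintype.card X + 1 :=
  armLen_le (glueLen_mem _) e y

theorem getD_mem {i : ℕ} (hi : i < M.cells.length) : M.cells.getD i (0, 0) ∈ M.cells := by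
  rw [List.getD_eq_getElem _ _ hi]
  exact List.getElem_mem _

theorem near_getD {i : ℕ} (hi : i < M.cells.length) : Near M.arms (M.cells.getD i (0, 0)) :=
  near_of_mem (getD_mem hi)

theorem exists_getD {p : Pos} (hp : p ∈ M.cells) :
    ∃ i < M.cells.length, M.cells.getD i (0, 0) = p := by
  obtain ⟨i, hi, e⟩ := List.mem_iff_getElem.1 hp
  exact ⟨i, hi, by rw [List.getD_eq_getElem _ _ hi, e]⟩

theorem length_cells :
    M.cells.length = 25 + 8 * (Fintype.card X + 1) + if M.hasOut then Fintype.card X + 1 else 0 :=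
  length_macroCells (glueLen_mem _)

theorem arms_add_le (e : Fin 4) (y : ℤ) (h : glueLen M.tile e = glueLen M'.tile (e + 2))
    (hout : ¬ (M.outDir = some (vec e) ∧ M'.outDir = some (vec (e + 2)))) :
    M.arms e y + M'.arms (e + 2) (-y) ≤ Fintype.card X + 1 := by
  have := glueLen_mem M.tile e
  simp only [arms, armLen, exitOpt_eq_some]
  split_ifs <;> first | omega | exact absurd ⟨‹_›, ‹_›⟩ hout

theorem exists_overlap {e : Fin 4} (h : glueLen M.tile e ≠ glueLen M'.tile (e + 2)) (u : Pos) :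
    ∃ p ∈ M.cells, ∃ q ∈ M'.cells,
      sc ((Fintype.card X + 1 : ℕ) + 5) u + p = sc ((Fintype.card X + 1 : ℕ) + 5) (u + vec e) + q := by
  have h1 := glueLen_mem M.tile e
  have h2 := glueLen_mem M'.tile (e + 2)
  have key : ∀ (y : ℤ) (j j' : ℕ), (y = 1 ∨ y = -1) → j < M.arms e y → j' < M'.arms (e + 2) (-y) →
      j + j' + 1 = Fintype.card X + 1 → ∃ p ∈ M.cells, ∃ q ∈ M'.cells,
      sc ((Fintype.card X + 1 : ℕ) + 5) u + p = sc ((Fintype.card X + 1 : ℕ) + 5) (u + vec e) + q := by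
    intro y j j' hy hj hj' hs
    refine ⟨_, arm_mem_macroCells hy hj, _, arm_mem_macroCells (by omega) hj', ?_⟩
    rw [sc_add, add_assoc, ← pt_overlap _ e (a := 3 + j) (by omega)]
  rcases lt_or_gt_of_ne h with h | h
  · refine key (-1) (Fintype.card X + 1 - glueLen M'.tile (e + 2)) (glueLen M'.tile (e + 2) - 1)
      (.inr rfl) ?_ ?_ ?_ <;> simp [arms, armLen] <;> omega
  · refine key 1 (glueLen M.tile e - 1) (Fintype.card X + 1 - glueLen M.tile e)
      (.inl rfl) ?_ ?_ ?_ <;> simp [arms, armLen] <;> omega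

end MacroTile

open MacroTile

/-- The macro-tiles, as a scheme. -/
noncomputable def macroScheme {X : Type} [Fintype X] {T : Set (Tile X Nvn)} (hT : T.Finite) : Scheme T where
  Mac := MacroTile T
  mac_finite := MacroTile.finite hT
  lab M := M.tile
  lab_mem M := M.tile_mem
  s := (Fintype.card X + 1 : ℕ) + 5
  hs := by omega
  n M := M.cells.length
  c M i := M.cells.getD i (0, 0)
  inDir := MacroTile.inDir
  outDir := MacroTile.outDir
  port v := (-2 * v.1, -2 * v.2)
  len := 25 + 8 * (Fintype.card X + 1) + (Fintype.card X + 1)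
  two_lt M := by
    rw [length_cells]
    omega
  n_le M := by
    rw [length_cells]
    split_ifs <;> omega
  n_eq M d h := by
    rw [length_cells, if_pos (outDir_eq_some.1 h).1]
  inj M i j hi hj h := by
    rw [List.getD_eq_getElem _ _ hi, List.getD_eq_getElem _ _ hj] at h
    exact (List.Nodup.getElem_inj_iff macroCells_nodup).1 h
  adj M i hi := by
    rw [List.getD_eq_getElem _ _ hi, List.getD_eq_getElem _ _ (Nat.lt_of_succ_lt hi)]
    exact List.isChain_iff_getElem.1 (macroCells_isChain (glueLen_mem _)) i hi
  zero_mem M := exists_getD (core_mem_macroCells (by simp))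
  head M d h := by
    obtain ⟨-, rfl⟩ := inDir_eq_some.1 h
    refine macroCells_head.trans ?_
    generalize M.dir = d
    fin_cases d <;> rfl
  last M d h := by
    obtain ⟨ho, rfl⟩ := outDir_eq_some.1 h
    have := macroCells_last (d := M.dir) (τ := M.turn) (glueLen_mem M.tile)
    rw [← ho] at this
    rw [length_cells, if_pos ho]
    refine (congrArg (· + _) this).trans ?_
    generalize exitDir M.dir M.turn = d
    fin_cases d <;> ext <;> simp [pt, vec, sc] <;> ring
  in_mem M d h := by
    obtain ⟨-, rfl⟩ := inDir_eq_some.1 h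
    exact vec_mem _
  out_mem M d h := by
    obtain ⟨-, rfl⟩ := outDir_eq_some.1 h
    exact vec_mem _
  entry_free M d h i hi := by
    obtain ⟨-, rfl⟩ := inDir_eq_some.1 h
    have hn := (near_getD hi).cases
    have h0 : M.arms (M.dir + 2) 0 = 0 := by
      have h1 : exitOpt M.dir M.turn M.hasOut ≠ some (M.dir + 2) := by
        rw [Ne, exitOpt_eq_some, outDir_eq_some, vec_injective.eq_iff]
        exact fun h => exitDir_ne _ _ h.2
      simp [arms, armLen, h1]
    intro e
    rw [eq_sub_of_add_eq e] at hn
    generalize M.dir = d at hn h0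
    fin_cases d <;> simp [vec] at hn h0 <;> omega
  exit_free M d h i hi := by
    obtain ⟨-, rfl⟩ := outDir_eq_some.1 h
    have hn := (near_getD hi).le arms_le
    intro e
    rw [e] at hn
    generalize exitDir M.dir M.turn = d at hn
    fin_cases d <;> simp [vec, sc] at hn <;> omega
  exists_mac t ht i o hi ho hio := by
    have hd : ∃ d, (∀ v, i = some v → vec d = v) ∧
        ∀ v, o = some v → ∃ τ, vec (exitDir d τ) = v := by
      rcases i with _ | v
      · rcases o with _ | v
        · exact ⟨0, by simp⟩
        · obtain ⟨e, rfl⟩ := exists_vec (ho _ rfl)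
          refine ⟨e, by simp, fun v hv => ⟨0, ?_⟩⟩
          cases hv
          simp [exitDir]
      · obtain ⟨d, rfl⟩ := exists_vec (hi _ rfl)
        refine ⟨d, fun v hv => Option.some.inj hv, ?_⟩
        rintro v rfl
        obtain ⟨e, rfl⟩ := exists_vec (ho _ rfl)
        obtain ⟨τ, rfl⟩ := exists_exitDir d e fun h => hio _ rfl (by rw [h])
        exact ⟨τ, rfl⟩
    obtain ⟨d, h1, h2⟩ := hd
    have h3 : ∃ τ, ∀ v, o = some v → vec (exitDir d τ) = v := by
      rcases o with _ | v
      · exact ⟨0, by simp⟩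
      · obtain ⟨τ, h⟩ := h2 v rfl
        exact ⟨τ, fun v' hv => h.trans (Option.some.inj hv)⟩
    obtain ⟨τ, h3⟩ := h3
    refine ⟨⟨t, ht, d, τ, i.isSome, o.isSome⟩, rfl, ?_, ?_⟩
    · rcases i with _ | v
      · rfl
      · exact congrArg some (h1 v rfl)
    · rcases o with _ | v
      · rfl
      · exact congrArg some (h3 v rfl)
  disjoint M M' u u' hu hl ho i hi j hj e := by
    refine Near.ne arms_le arms_le (v := u' - u) (sub_ne_zero.2 hu.symm) ?_ (near_getD hi)
      (near_getD hj) ?_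
    · intro d y hd
      refine arms_add_le d y ?_ ?_
      · rw [glueLen_eq_iff]
        have hd' : vec (d + 2) = -(u' - u) := by rw [vec_add_two, hd]
        have := hl (hd ▸ vec_mem d) (hd' ▸ vec_mem _)
        simpa only [hd, hd'] using this
      · rwa [vec_add_two, ← hd, neg_sub]
    · have : sc ((Fintype.card X + 1 : ℕ) + 5) u' =
          sc ((Fintype.card X + 1 : ℕ) + 5) u + sc ((Fintype.card X + 1 : ℕ) + 5) (u' - u) := by
        rw [← sc_add, add_sub_cancel]
      rw [this, add_assoc] at e
      exact add_left_cancel e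
  collide M M' u v hv hv' h := by
    obtain ⟨e, rfl⟩ := exists_vec hv
    obtain ⟨p, hp, q, hq, h⟩ := exists_overlap (M := M) (M' := M') (e := e)
      (by rw [Ne, glueLen_eq_iff]; simpa only [vec_add_two] using h) u
    obtain ⟨i, hi, rfl⟩ := exists_getD hp
    obtain ⟨j, hj, rfl⟩ := exists_getD hq
    exact ⟨i, hi, j, hj, h⟩

/-- simulation of von Neumann-neighborhood zippers by ribbons. -/
theorem stmt4 (X : Type) [Fintype X] (T : Set (Tile X Nvn)) (hT : T.Finite) :
    ∃ (Xμ : Type) (_ : Fintype Xμ) (Tμ : Set (Tile Xμ Nvn)) (_ : Tμ.Finite)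
      (s : ℤ) (sim : ZipperSimulation X Xμ Nvn T Tμ s),
      ∀ I P r, IsZipper T I P r → ∃ R : Ribbon Xμ Tμ, sim.chi R ∈ sim.psi I P r := by
  exact (macroScheme hT).exists_zipperSimulation

end Paper
end
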